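/- arXiv:0905.2939 — 5 statements merged into one kernel-verified Lean document; each statement's English description precedes it below -/
import Mathlib

section
/- Let g = ⊕_{i ∈ ℤ/mℤ} g_i be a finite-dimensional real ℤ_m-graded semisimple Lie algebra. Every homogeneous element x ∈ g_i admits a unique decomposition x = x_s + x_n in which x_s is a semisimple element of g, x_n is a nilpotent element of g, both x_s and x_n lie in the same graded component g_i, and ⁅x_s, x_n⁆ = 0. -/
open Polynomial TensorProduct

namespace Module.End

variable {K V W : Type*} [Field K] [AddCommGroup V] [Module K V] [AddCommGroup W] [Module K W]

/-- Semisimplicity passes from `A` to any endomorphism killed by all polynomials that kill `A`. -/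
lemma IsSemisimple.of_aeval_eq_zero_imp [FiniteDimensional K V] {A : End K V} {T : End K W}
    (hA : A.IsSemisimple) (h : ∀ p : K[X], aeval A p = 0 → aeval T p = 0) : T.IsSemisimple :=
  isSemisimple_of_squarefree_aeval_eq_zero hA.minpoly_squarefree (h _ (minpoly.aeval K A))

lemma IsSemisimple.map_algHom [FiniteDimensional K V] {A : End K V}
    (hA : A.IsSemisimple) (F : End K V →ₐ[K] End K W) : (F A).IsSemisimple :=
  hA.of_aeval_eq_zero_imp fun p hp ↦ by rw [aeval_algHom_apply, hp, map_zero]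

lemma aeval_lcomp_apply (A : End K V) (p : K[X]) (φ : V →ₗ[K] W) :
    aeval (LinearMap.lcomp K W A : End K (V →ₗ[K] W)) p φ = φ ∘ₗ aeval A p := by
  induction p using Polynomial.induction_on generalizing φ with
  | C a => ext v; simp [Module.algebraMap_end_apply]
  | add p q hp hq => simp [hp, hq, LinearMap.comp_add]
  | monomial n a h =>
    rw [pow_succ, ← mul_assoc, map_mul _ (C a * X ^ n), mul_apply, h, mul_comm _ X,
      map_mul _ X]
    simp only [aeval_X]
    rfl

lemma aeval_compRight_apply (B : End K W) (p : K[X]) (φ : V →ₗ[K] W) :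
    aeval (LinearMap.compRight K (M := V) B : End K (V →ₗ[K] W)) p φ = aeval B p ∘ₗ φ := by
  induction p using Polynomial.induction_on generalizing φ with
  | C a => ext v; simp [Module.algebraMap_end_apply]
  | add p q hp hq => simp [hp, hq, LinearMap.add_comp]
  | monomial n a h =>
    rw [pow_succ, ← mul_assoc, map_mul _ (C a * X ^ n), mul_apply, h, map_mul _ (C a * X ^ n)]
    simp only [aeval_X]
    rfl

/-- On the kernel of the sum of a semisimple and a nilpotent endomorphism which commute,
the semisimple one vanishes. -/
lemma IsSemisimple.apply_eq_zero_of_add_apply_eq_zero {S N : End K V} (hS : S.IsSemisimple)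
    (hN : IsNilpotent N) (hSN : Commute S N) {v : V} (hv : (S + N) v = 0) : S v = 0 := by
  have hinv : ∀ {T : End K V}, Commute T (S + N) →
      ∀ w ∈ LinearMap.ker (S + N), T w ∈ LinearMap.ker (S + N) := fun {T} hT w hw ↦ by
    have := LinearMap.congr_fun hT.eq w
    simp only [mul_apply, LinearMap.mem_ker.mp hw, map_zero] at this
    exact this.symm
  have hS' := hinv ((Commute.refl S).add_right hSN)
  have hN' := hinv (hSN.symm.add_right (Commute.refl N))
  have heq : S.restrict hS' = -N.restrict hN' := by
    ext w
    exact eq_neg_of_add_eq_zero_left w.2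
  have h0 : S.restrict hS' = 0 := eq_zero_of_isNilpotent_isSemisimple
    (heq ▸ (isNilpotent.restrict hN' hN).neg) (hS.restrict hS')
  exact congrArg Subtype.val (LinearMap.congr_fun h0 ⟨v, hv⟩)

variable [PerfectField K] [FiniteDimensional K V] [FiniteDimensional K W]

/-- Functoriality of the semisimple part: a linear map intertwining two endomorphisms also
intertwines their semisimple parts. -/
lemma comp_semisimple_eq_of_comp_eq {f : V →ₗ[K] W} {S N : End K V} {S' N' : End K W}
    (hS : S.IsSemisimple) (hN : IsNilpotent N) (hSN : Commute S N)
    (hS' : S'.IsSemisimple) (hN' : IsNilpotent N') (hSN' : Commute S' N')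
    (hf : f ∘ₗ (S + N) = (S' + N') ∘ₗ f) : f ∘ₗ S = S' ∘ₗ f := by
  let l (B : End K W) : End K (V →ₗ[K] W) := LinearMap.compRight K B
  let r (A : End K V) : End K (V →ₗ[K] W) := LinearMap.lcomp K W A
  have hl : ∀ (B : End K W) (p : K[X]), aeval B p = 0 → aeval (l B) p = 0 := fun B p h ↦
    LinearMap.ext fun φ ↦ by simp [l, aeval_compRight_apply, h]
  have hr : ∀ (A : End K V) (p : K[X]), aeval A p = 0 → aeval (r A) p = 0 := fun A p h ↦
    LinearMap.ext fun φ ↦ by simp [r, aeval_lcomp_apply, h]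
  have hlr : ∀ A B, Commute (l B) (r A) := fun A B ↦ rfl
  have hll : ∀ {A B}, Commute A B → Commute (l A) (l B) := fun {A B} h ↦
    LinearMap.ext fun φ ↦ congrArg (· ∘ₗ φ) h.eq
  have hrr : ∀ {A B}, Commute A B → Commute (r A) (r B) := fun {A B} h ↦
    LinearMap.ext fun φ ↦ congrArg (φ ∘ₗ ·) h.symm.eq
  have hl_nil : IsNilpotent (l N') := by
    obtain ⟨k, hk⟩ := hN'
    exact ⟨k, by simpa using hl N' (X ^ k) (by simpa using hk)⟩
  have hr_nil : IsNilpotent (r N) := by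
    obtain ⟨k, hk⟩ := hN
    exact ⟨k, by simpa using hr N (X ^ k) (by simpa using hk)⟩
  have key := IsSemisimple.apply_eq_zero_of_add_apply_eq_zero (v := f)
    (IsSemisimple.sub_of_commute (hlr S S') (hS'.of_aeval_eq_zero_imp (hl S'))
      (hS.of_aeval_eq_zero_imp (hr S)))
    ((hlr N N').isNilpotent_sub hl_nil hr_nil)
    (((hll hSN').sub_right (hlr N S')).sub_left ((hlr S N').symm.sub_right (hrr hSN)))
    (by
      have h : S' ∘ₗ f - f ∘ₗ S + (N' ∘ₗ f - f ∘ₗ N) = 0 := by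
        rw [LinearMap.comp_add, LinearMap.add_comp] at hf
        rw [sub_add_sub_comm, hf, sub_self]
      exact h)
  exact (sub_eq_zero.mp (show S' ∘ₗ f - f ∘ₗ S = 0 from key)).symm

end Module.End

section Derivation

variable {K L : Type*} [Field K] [PerfectField K] [LieRing L] [LieAlgebra K L] [Module.Finite K L]

/-- The semisimple part of a derivation of a finite-dimensional Lie algebra is a derivation. -/
lemma Module.End.IsSemisimple.apply_lie_of_add {S N : Module.End K L} (hS : S.IsSemisimple)
    (hN : IsNilpotent N) (hSN : Commute S N)
    (hD : ∀ a b : L, (S + N) ⁅a, b⁆ = ⁅(S + N) a, b⁆ + ⁅a, (S + N) b⁆) (a b : L) :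
    S ⁅a, b⁆ = ⁅S a, b⁆ + ⁅a, S b⁆ := by
  let l := Module.End.lTensorAlgHom K L L
  let r := Module.End.rTensorAlgHom K L L
  have hl : ∀ A x y, l A (x ⊗ₜ y) = x ⊗ₜ A y := fun _ _ _ ↦ rfl
  have hr : ∀ A x y, r A (x ⊗ₜ y) = A x ⊗ₜ y := fun _ _ _ ↦ rfl
  have hlr : ∀ A B, Commute (l A) (r B) := fun A B ↦ TensorProduct.ext' fun x y ↦ rfl
  let f : L ⊗[K] L →ₗ[K] L := LieModule.toModuleHom K L L
  have hf : ∀ x y : L, f (x ⊗ₜ y) = ⁅x, y⁆ := fun x y ↦ LieModule.toModuleHom_apply K L L x y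
  have key := Module.End.comp_semisimple_eq_of_comp_eq (f := f) (S := l S + r S) (N := l N + r N)
    (Module.End.IsSemisimple.add_of_commute (hlr S S) (hS.map_algHom l) (hS.map_algHom r))
    ((hlr N N).isNilpotent_add (hN.map l) (hN.map r))
    (((hSN.map l).add_right (hlr S N)).add_left ((hlr N S).symm.add_right (hSN.map r)))
    hS hN hSN
    (by
      refine TensorProduct.ext' fun x y ↦ ?_
      have := hD x y
      simp only [LinearMap.add_apply, add_lie, lie_add] at this
      simp only [LinearMap.comp_apply, LinearMap.add_apply, map_add, hl, hr, hf, this]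
      abel)
  have := LinearMap.congr_fun key (a ⊗ₜ b)
  simp only [LinearMap.comp_apply, LinearMap.add_apply, map_add, hl, hr, hf] at this
  rw [← this, add_comm]

end Derivation

section Graded

variable {K V G : Type*} [Field K] [AddCommGroup V] [Module K V] [AddCommGroup G]

/-- Pointwise application of an endomorphism to functions, as an algebra homomorphism. -/
def Module.End.compLeftAlgHom (K V G : Type*) [Field K] [AddCommGroup V] [Module K V] :
    Module.End K V →ₐ[K] Module.End K (G → V) where
  toFun D := D.compLeft G
  map_one' := rfl
  map_mul' _ _ := rfl
  map_zero' := rfl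
  map_add' _ _ := rfl
  commutes' _ := rfl

lemma LinearMap.funLeft_sub_right_pow_apply (i : G) (n : ℕ) (f : G → V) (j : G) :
    ((LinearMap.funLeft K V (· - i) : Module.End K (G → V)) ^ n) f j = f (j - n • i) := by
  induction n generalizing j with
  | zero => simp
  | succ n ih =>
    rw [pow_succ', Module.End.mul_apply, LinearMap.funLeft_apply, ih, succ_nsmul', sub_sub]

variable [CharZero K] [Finite G]

lemma LinearMap.isSemisimple_funLeft_sub_right (i : G) :
    Module.End.IsSemisimple (LinearMap.funLeft K V (· - i) : Module.End K (G → V)) := by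
  have hG : (Nat.card G : K) ≠ 0 := Nat.cast_ne_zero.mpr Nat.card_pos.ne'
  refine Module.End.isSemisimple_of_squarefree_aeval_eq_zero
    (separable_X_pow_sub_C (1 : K) hG one_ne_zero).squarefree ?_
  ext1 f
  ext1 j
  simp [LinearMap.funLeft_sub_right_pow_apply, card_nsmul_eq_zero']

variable [FiniteDimensional K V]

/-- If an endomorphism shifts by `i` a family of maps indexed by a finite abelian group, for
instance the projections of a grading, then so does its semisimple part. -/
lemma Module.End.IsSemisimple.apply_shift_of_add {S N : Module.End K V} (hS : S.IsSemisimple)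
    (hN : IsNilpotent N) (hSN : Commute S N) (P : G → Module.End K V) (i : G)
    (hP : ∀ j v, P j ((S + N) v) = (S + N) (P (j - i) v)) (j : G) (v : V) :
    P j (S v) = S (P (j - i) v) := by
  let T : Module.End K (G → V) := LinearMap.funLeft K V (· - i)
  let c := Module.End.compLeftAlgHom K V G
  have hTc : ∀ A, Commute (c A) T := fun A ↦ rfl
  have key := Module.End.comp_semisimple_eq_of_comp_eq (f := LinearMap.pi P)
    (S' := c S * T) (N' := c N * T) hS hN hSN
    (Module.End.IsSemisimple.mul_of_commute (hTc S) (hS.map_algHom c)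
      (LinearMap.isSemisimple_funLeft_sub_right i))
    ((hTc N).isNilpotent_mul_right (hN.map c))
    (((hSN.map c).mul_right (hTc S)).mul_left ((hTc N).symm.mul_right (Commute.refl T)))
    (by
      ext1 v
      ext1 j
      exact hP j v)
  exact congrFun (LinearMap.congr_fun key v) j

end Graded

section Adjoint

lemma LieAlgebra.eq_of_forall_lie_eq (R : Type*) {L : Type*} [CommRing R] [LieRing L]
    [LieAlgebra R L] [LieAlgebra.HasTrivialRadical R L] {a b : L}
    (h : ∀ y : L, ⁅a, y⁆ = ⁅b, y⁆) : a = b := by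
  have hmem : a - b ∈ LieAlgebra.center R L := fun y ↦ by
    rw [← lie_skew, sub_lie, h, sub_self, neg_zero]
  rwa [LieAlgebra.center_eq_bot, LieSubmodule.mem_bot, sub_eq_zero] at hmem

variable {R L : Type*} [CommRing R] [LieRing L] [LieAlgebra R L] [LieAlgebra.HasTrivialRadical R L]

lemma LieAlgebra.eq_of_ad_eq {a b : L} (h : LieAlgebra.ad R L a = LieAlgebra.ad R L b) : a = b :=
  LieAlgebra.eq_of_forall_lie_eq R fun y ↦ LinearMap.congr_fun h y

lemma LieAlgebra.commute_ad_iff {a b : L} :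
    Commute (LieAlgebra.ad R L a) (LieAlgebra.ad R L b) ↔ ⁅a, b⁆ = 0 := by
  refine ⟨fun h ↦ LieAlgebra.eq_of_forall_lie_eq R fun y ↦ ?_, fun h ↦ ?_⟩
  · rw [lie_lie, zero_lie, sub_eq_zero]
    exact LinearMap.congr_fun h.eq y
  · refine LinearMap.ext fun y ↦ ?_
    have := lie_lie a b y
    rw [h, zero_lie, eq_comm, sub_eq_zero] at this
    exact this

end Adjoint

section Projection

variable {R L G : Type*} [CommRing R] [LieRing L] [LieAlgebra R L] [DecidableEq G]
  (g : G → Submodule R L) [DirectSum.Decomposition g]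

/-- The projection of `L` onto its component of degree `j`. -/
def LieAlgebra.gradedProj (j : G) : Module.End R L :=
  (g j).subtype ∘ₗ DirectSum.component R G (fun k ↦ g k) j ∘ₗ
    (DirectSum.decomposeLinearEquiv g).toLinearMap

variable {g}

lemma LieAlgebra.gradedProj_of_mem {j : G} {y : L} (hy : y ∈ g j) :
    LieAlgebra.gradedProj g j y = y :=
  DirectSum.decompose_of_mem_same g hy

lemma LieAlgebra.gradedProj_of_mem_of_ne {j k : G} {y : L} (hy : y ∈ g k) (h : k ≠ j) :
    LieAlgebra.gradedProj g j y = 0 :=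
  DirectSum.decompose_of_mem_ne g hy h

variable [AddCommGroup G]

lemma LieAlgebra.gradedProj_lie (hgb : ∀ i j : G, ∀ x ∈ g i, ∀ y ∈ g j, ⁅x, y⁆ ∈ g (i + j))
    {i : G} {x : L} (hx : x ∈ g i) (j : G) (v : L) :
    LieAlgebra.gradedProj g j ⁅x, v⁆ = ⁅x, LieAlgebra.gradedProj g (j - i) v⁆ := by
  induction v using DirectSum.Decomposition.inductionOn g with
  | zero => simp
  | add a b ha hb => rw [lie_add, map_add, map_add, lie_add, ha, hb]
  | @homogeneous k y =>
    have hxy := hgb i k x hx y y.2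
    obtain rfl | h := eq_or_ne (i + k) j
    · rw [gradedProj_of_mem hxy, add_sub_cancel_left, gradedProj_of_mem y.2]
    · rw [gradedProj_of_mem_of_ne hxy h, gradedProj_of_mem_of_ne y.2, lie_zero]
      rintro rfl
      exact h (add_sub_cancel i j)

/-- An element whose adjoint action is homogeneous of degree `i` is homogeneous of degree `i`. -/
lemma LieAlgebra.mem_of_gradedProj_lie [LieAlgebra.HasTrivialRadical R L]
    (hgb : ∀ i j : G, ∀ x ∈ g i, ∀ y ∈ g j, ⁅x, y⁆ ∈ g (i + j)) {i : G} {s : L}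
    (hs : ∀ j v, LieAlgebra.gradedProj g j ⁅s, v⁆ = ⁅s, LieAlgebra.gradedProj g (j - i) v⁆) :
    s ∈ g i := by
  suffices h : LieAlgebra.gradedProj g i s = s from h ▸ (DirectSum.decompose g s i).2
  refine LieAlgebra.eq_of_forall_lie_eq R fun v ↦ ?_
  induction v using DirectSum.Decomposition.inductionOn g with
  | zero => simp
  | add a b ha hb => rw [lie_add, lie_add, ha, hb]
  | @homogeneous k y =>
    have h₁ := hs (i + k) y
    have h₂ := gradedProj_lie hgb y.2 (i + k) s
    rw [add_sub_cancel_left, gradedProj_of_mem y.2, ← lie_skew, map_neg] at h₁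
    rw [add_sub_cancel_right] at h₂
    rw [neg_inj, h₂] at h₁
    rw [← lie_skew, h₁, lie_skew]

end Projection

section JordanDecomposition

/-- A version of the Jordan-Chevalley decomposition recording only that the parts commute. -/
lemma Module.End.exists_isSemisimple_isNilpotent_commute {K V : Type*} [Field K] [PerfectField K]
    [AddCommGroup V] [Module K V] [FiniteDimensional K V] (f : Module.End K V) :
    ∃ S N : Module.End K V, S.IsSemisimple ∧ IsNilpotent N ∧ Commute S N ∧ f = S + N := by
  obtain ⟨N, hN_mem, S, hS_mem, hN, hS, hf⟩ := f.exists_isNilpotent_isSemisimple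
  exact ⟨S, N, hS, hN, Algebra.commute_of_mem_adjoin_singleton_of_commute hN_mem
    (Algebra.commute_of_mem_adjoin_self hS_mem).symm, hf.trans (add_comm N S)⟩

variable {K L : Type*} [Field K] [CharZero K] [LieRing L] [LieAlgebra K L] [Module.Finite K L]
  [LieAlgebra.HasTrivialRadical K L]

/-- The semisimple part of an inner derivation is inner. -/
lemma Module.End.IsSemisimple.exists_ad_eq {x : L} {S N : Module.End K L} (hS : S.IsSemisimple)
    (hN : IsNilpotent N) (hSN : Commute S N) (hx : LieAlgebra.ad K L x = S + N) :
    ∃ s, LieAlgebra.ad K L s = S := by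
  let D : LieDerivation K L L :=
    { S with
      leibniz' := fun a b ↦ by
        have := hS.apply_lie_of_add hN hSN (fun a b ↦ by simp [← hx]) a b
        rw [← lie_skew b (S a)]
        simpa [sub_eq_add_neg, add_comm] using this }
  obtain ⟨s, hs⟩ := LieDerivation.IsKilling.exists_eq_ad D
  exact ⟨s, by rw [← LieDerivation.coe_ad_apply_eq_ad_apply, hs]⟩

/-- The Jordan decomposition of a homogeneous element of a semisimple Lie algebra graded by a
finite abelian group. -/
lemma LieAlgebra.existsUnique_jordan_of_mem {G : Type*} [AddCommGroup G] [Finite G]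
    [DecidableEq G] (g : G → Submodule K L) [DirectSum.Decomposition g]
    (hgb : ∀ i j : G, ∀ x ∈ g i, ∀ y ∈ g j, ⁅x, y⁆ ∈ g (i + j)) {i : G} {x : L} (hx : x ∈ g i) :
    ∃! p : L × L, x = p.1 + p.2 ∧ p.1 ∈ g i ∧ p.2 ∈ g i ∧
      (LieAlgebra.ad K L p.1).IsSemisimple ∧ IsNilpotent (LieAlgebra.ad K L p.2) ∧
      ⁅p.1, p.2⁆ = 0 := by
  obtain ⟨S, N, hS, hN, hSN, hx_eq⟩ :=
    (LieAlgebra.ad K L x).exists_isSemisimple_isNilpotent_commute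
  obtain ⟨s, hs⟩ := hS.exists_ad_eq hN hSN hx_eq
  have hn : LieAlgebra.ad K L (x - s) = N := by
    refine LinearMap.ext fun y ↦ ?_
    have hx_y : ⁅x, y⁆ = S y + N y := LinearMap.congr_fun hx_eq y
    rw [LieAlgebra.ad_apply, sub_lie, hx_y, ← hs, LieAlgebra.ad_apply, add_sub_cancel_left]
  have hsi : s ∈ g i := by
    refine LieAlgebra.mem_of_gradedProj_lie hgb fun j v ↦ ?_
    have := hS.apply_shift_of_add hN hSN (LieAlgebra.gradedProj g) i
      (fun j v ↦ by rw [← hx_eq]; exact LieAlgebra.gradedProj_lie hgb hx j v) j v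
    rwa [← hs] at this
  refine ⟨(s, x - s), ⟨by simp, hsi, sub_mem hx hsi, hs ▸ hS, hn ▸ hN,
    LieAlgebra.commute_ad_iff.mp (by rwa [hs, hn])⟩, ?_⟩
  rintro ⟨a, b⟩ ⟨hab, -, -, ha, hb, hab0⟩
  have hab_eq : LieAlgebra.ad K L b + LieAlgebra.ad K L a = N + S := by
    rw [add_comm N, ← hx_eq]
    refine LinearMap.ext fun y ↦ ?_
    simp only at hab
    simp [hab, add_comm]
  obtain ⟨h₁, h₂⟩ := Module.End.isNilpotent_isSemisimple_unique hb ha hN hS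
    (LieAlgebra.commute_ad_iff.mpr hab0).symm hSN.symm hab_eq
  exact Prod.ext (LieAlgebra.eq_of_ad_eq (h₂.trans hs.symm))
    (LieAlgebra.eq_of_ad_eq (h₁.trans hn.symm))

end JordanDecomposition

/-- **Jordan decomposition in a real `ℤ/m`-graded semisimple Lie algebra.**
Every homogeneous element `x ∈ g_i` has a unique decomposition `x = x_s + x_n` with `x_s`
semisimple, `x_n` nilpotent, both `x_s, x_n ∈ g_i`, and `⁅x_s, x_n⁆ = 0`. -/
theorem graded_jordan_decomposition {m : ℕ} [NeZero m] {L : Type*} [LieRing L]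
    [LieAlgebra ℝ L] [Module.Finite ℝ L] [LieAlgebra.IsSemisimple ℝ L]
    (g : ZMod m → Submodule ℝ L) (hg : DirectSum.IsInternal g)
    (hgb : ∀ i j : ZMod m, ∀ x ∈ g i, ∀ y ∈ g j, ⁅x, y⁆ ∈ g (i + j))
    (i : ZMod m) (x : L) (hx : x ∈ g i) :
    ∃! p : L × L, x = p.1 + p.2 ∧ p.1 ∈ g i ∧ p.2 ∈ g i ∧
      (LieAlgebra.ad ℝ L p.1).IsSemisimple ∧ IsNilpotent (LieAlgebra.ad ℝ L p.2) ∧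
      ⁅p.1, p.2⁆ = 0 := by
  let _ : DirectSum.Decomposition g := hg.chooseDecomposition
  exact LieAlgebra.existsUnique_jordan_of_mem g hgb hx
end

section
/- Every finite-dimensional real ℤ_m-graded semisimple Lie algebra g = ⊕_{i ∈ ℤ/mℤ} g_i admits a Cartan involution which reverses the gradation: there exists an involutive Lie algebra automorphism τ of g such that τ(g_k) = g_{−k} for every k ∈ ℤ/mℤ and such that the symmetric bilinear form B_τ(x, y) = −κ(x, τ(y)) is positive definite on g, where κ denotes the Killing form of g. -/
open scoped InnerProductSpace Topology

namespace GradedCartan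

section Bracket

variable {V : Type*} [NormedAddCommGroup V] [InnerProductSpace ℝ V]

/-- A bilinear operation satisfying the axioms of a Lie bracket. -/
structure IsBracket (c : V →L[ℝ] V →L[ℝ] V) : Prop where
  skew : ∀ x y, c x y = -c y x
  jacobi : ∀ x y z, c x (c y z) = c (c x y) z + c y (c x z)

/-- The trace form of a bilinear operation. -/
noncomputable def kil (c : V →L[ℝ] V →L[ℝ] V) : LinearMap.BilinForm ℝ V :=
  LinearMap.mk₂ ℝ
    (fun x y => LinearMap.trace ℝ V ((c x : V →ₗ[ℝ] V) ∘ₗ (c y : V →ₗ[ℝ] V)))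
    (fun x y z => by simp [LinearMap.add_comp]) (fun a x y => by simp [LinearMap.smul_comp])
    (fun x y z => by simp [LinearMap.comp_add]) (fun a x y => by simp [LinearMap.comp_smul])

theorem kil_apply (c : V →L[ℝ] V →L[ℝ] V) (x y : V) :
    kil c x y = LinearMap.trace ℝ V ((c x : V →ₗ[ℝ] V) ∘ₗ (c y : V →ₗ[ℝ] V)) := rfl

theorem kil_comm (c : V →L[ℝ] V →L[ℝ] V) (x y : V) : kil c x y = kil c y x := by
  rw [kil_apply, kil_apply]; exact LinearMap.trace_mul_comm ℝ _ _

theorem IsBracket.coe_apply_apply {c : V →L[ℝ] V →L[ℝ] V} (hc : IsBracket c) (x y : V) :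
    (c (c x y) : V →ₗ[ℝ] V) = (c x : V →ₗ[ℝ] V) * (c y : V →ₗ[ℝ] V) -
      (c y : V →ₗ[ℝ] V) * (c x : V →ₗ[ℝ] V) := by
  ext z
  have := hc.jacobi x y z
  simp [this]

theorem IsBracket.kil_invariant {c : V →L[ℝ] V →L[ℝ] V} (hc : IsBracket c) (x y z : V) :
    kil c (c x y) z = kil c x (c y z) := by
  simp only [kil_apply, hc.coe_apply_apply, ← Module.End.mul_eq_comp, mul_sub, sub_mul, map_sub]
  rw [mul_assoc, mul_assoc, LinearMap.trace_mul_comm ℝ (c y : V →ₗ[ℝ] V), mul_assoc]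

variable {ι : Type*} [Fintype ι] [DecidableEq ι]

/-- The basis dual to `e` for the trace form. -/
noncomputable def dual (e : OrthonormalBasis ι ℝ V) {c : V →L[ℝ] V →L[ℝ] V}
    (hk : (kil c).Nondegenerate) : Module.Basis ι ℝ V :=
  (kil c).dualBasis hk e.toBasis

variable (e : OrthonormalBasis ι ℝ V) {c : V →L[ℝ] V →L[ℝ] V} (hk : (kil c).Nondegenerate)

theorem dual_repr (x : V) (i : ι) : (dual e hk).repr x i = kil c x (e i) := by
  simp [dual, LinearMap.BilinForm.dualBasis_repr_apply]

theorem sum_kil_smul_dual (x : V) : ∑ i, kil c x (e i) • dual e hk i = x := by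
  simp only [← dual_repr e hk]; exact (dual e hk).sum_repr x

theorem kil_dual (i j : ι) : kil c (dual e hk i) (e j) = if j = i then 1 else 0 := by
  have := LinearMap.BilinForm.apply_dualBasis_left (B := kil c) hk e.toBasis i j
  simpa [dual] using this

theorem sum_kil_dual_smul (x : V) : ∑ i, kil c x (dual e hk i) • e i = x := by
  have h : ∀ i, kil c x (dual e hk i) = ⟪e i, x⟫_ℝ := fun i => by
    conv_lhs => rw [← e.sum_repr' x]
    rw [kil_comm]
    simp [map_sum, kil_dual]
  simp only [h, e.sum_repr']

theorem IsBracket.sum_swap (hc : IsBracket c) (β : V →L[ℝ] V →L[ℝ] V) (x : V) :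
    ∑ i, β (c (e i) x) (dual e hk i) = -∑ i, β (e i) (c (dual e hk i) x) := by
  have h1 : ∀ i, β (c (e i) x) (dual e hk i) =
      ∑ j, kil c (c (e i) x) (dual e hk j) • β (e j) (dual e hk i) := fun i => by
    conv_lhs => rw [← sum_kil_dual_smul e hk (c (e i) x)]
    simp
  have h2 : ∀ i, β (e i) (c (dual e hk i) x) =
      ∑ j, kil c (c (dual e hk i) x) (e j) • β (e i) (dual e hk j) := fun i => by
    conv_lhs => rw [← sum_kil_smul_dual e hk (c (dual e hk i) x)]
    simp
  simp only [h1, h2]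
  rw [Finset.sum_comm, ← Finset.sum_neg_distrib]
  refine Finset.sum_congr rfl fun i _ => ?_
  rw [← Finset.sum_neg_distrib]
  refine Finset.sum_congr rfl fun j _ => ?_
  rw [hc.kil_invariant, hc.skew x, map_neg, neg_smul, kil_comm c (c _ x)]

theorem IsBracket.casimir (hc : IsBracket c) (x : V) :
    ∑ i, c (e i) (c (dual e hk i) x) = x := by
  have hinj : ∀ v w : V, (∀ y, kil c v y = kil c w y) → v = w := fun v w h => by
    rw [← sum_kil_smul_dual e hk v, ← sum_kil_smul_dual e hk w]; simp only [h]
  refine hinj _ _ fun y => ?_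
  rw [map_sum, LinearMap.sum_apply]
  have h : ∀ i, kil c (c (e i) (c (dual e hk i) x)) y =
      (dual e hk).repr (((c y : V →ₗ[ℝ] V) ∘ₗ (c x : V →ₗ[ℝ] V)) (dual e hk i)) i := fun i => by
    rw [dual_repr, hc.kil_invariant, kil_comm, hc.skew _ y, hc.skew _ x]
    simp
  simp only [h]
  rw [kil_comm, kil_apply, LinearMap.trace_eq_matrix_trace ℝ (dual e hk), Matrix.trace]
  simp [LinearMap.toMatrix_apply]

theorem IsBracket.derivation_eq (hc : IsBracket c) (D : V →L[ℝ] V)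
    (hD : ∀ x y, D (c x y) = c (D x) y + c x (D y)) (y : V) :
    D y = -c (∑ i, c (e i) (D (dual e hk i))) y := by
  have h0 : ∑ i, c (e i) (D (c (dual e hk i) y)) =
      ∑ i, c (e i) (c (D (dual e hk i)) y) + D y := by
    simp only [hD, map_add, Finset.sum_add_distrib, hc.casimir e hk (D y)]
  have h1 := hc.sum_swap e hk (c.bilinearComp (ContinuousLinearMap.id ℝ V) D) y
  simp only [ContinuousLinearMap.bilinearComp_apply, ContinuousLinearMap.id_apply] at h1
  have h2 : ∀ i, c (e i) (c (D (dual e hk i)) y) =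
      c (c (e i) (D (dual e hk i))) y - c (c (e i) y) (D (dual e hk i)) := fun i => by
    rw [hc.jacobi, hc.skew (D _) (c _ y)]; abel
  simp only [h2, Finset.sum_sub_distrib, h1] at h0
  rw [map_sum, sum_apply]
  have h3 : D y + ∑ i, c (c (e i) (D (dual e hk i))) y = 0 := by
    have := h0
    rw [sub_neg_eq_add] at this
    have h4 := sub_eq_zero.mpr this.symm
    rw [← h4]; abel
  exact eq_neg_of_add_eq_zero_left h3

include e hk in
theorem eq_of_apply_eq {x y : V} (h : c x = c y) : x = y := by
  have hxy : ∀ z, kil c x z = kil c y z := fun z => by simp [kil_apply, h]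
  rw [← sum_kil_smul_dual e hk x, ← sum_kil_smul_dual e hk y]; simp only [hxy]

end Bracket

section Cohomology

variable {V : Type*} [NormedAddCommGroup V] [InnerProductSpace ℝ V]
  {ι : Type*} [Fintype ι] [DecidableEq ι]

/-- The infinitesimal action of an endomorphism on a bilinear operation. -/
noncomputable def infAct (S : V →L[ℝ] V) (c : V →L[ℝ] V →L[ℝ] V) : V →L[ℝ] V →L[ℝ] V :=
  (ContinuousLinearMap.compL ℝ V V V S).comp c - c.comp S -
    c.bilinearComp (ContinuousLinearMap.id ℝ V) S

@[simp]
theorem infAct_apply (S : V →L[ℝ] V) (c : V →L[ℝ] V →L[ℝ] V) (x y : V) :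
    infAct S c x y = S (c x y) - c (S x) y - c x (S y) := rfl

/-- The Casimir contracting homotopy, from bilinear operations to endomorphisms. -/
noncomputable def contraction (e : OrthonormalBasis ι ℝ V) {c : V →L[ℝ] V →L[ℝ] V}
    (hk : (kil c).Nondegenerate) (ω : V →L[ℝ] V →L[ℝ] V) : V →L[ℝ] V :=
  ∑ i, (c (e i)).comp (ω (dual e hk i))

@[simp]
theorem contraction_apply (e : OrthonormalBasis ι ℝ V) {c : V →L[ℝ] V →L[ℝ] V}
    (hk : (kil c).Nondegenerate) (ω : V →L[ℝ] V →L[ℝ] V) (x : V) :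
    contraction e hk ω x = ∑ i, c (e i) (ω (dual e hk i) x) := by
  simp [contraction, sum_apply]

variable (e : OrthonormalBasis ι ℝ V) {c : V →L[ℝ] V →L[ℝ] V} (hk : (kil c).Nondegenerate)

theorem IsBracket.homotopy (hc : IsBracket c) (ω : V →L[ℝ] V →L[ℝ] V)
    (hω : ∀ x y, ω x y = -ω y x) (x y : V) :
    ω x y + infAct (contraction e hk ω) c x y =
      ∑ i, c (e i) (c (dual e hk i) (ω x y) + ω (dual e hk i) (c x y) -
        c (ω (dual e hk i) x) y - ω (c (dual e hk i) x) y -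
        c x (ω (dual e hk i) y) - ω x (c (dual e hk i) y)) := by
  set f := dual e hk with hf
  have hs : ∀ z w, ∑ i, c (c (e i) z) (ω (f i) w) = -∑ i, c (e i) (ω (c (f i) z) w) :=
    fun z w => hc.sum_swap e hk (c.bilinearComp (ContinuousLinearMap.id ℝ V) (ω.flip w)) z
  have h1 : ∀ i, c (e i) (c (ω (f i) x) y) =
      c (c (e i) (ω (f i) x)) y - c (c (e i) y) (ω (f i) x) := fun i => by
    rw [hc.jacobi, hc.skew (ω _ _) (c _ y)]; abel
  have h2 : ∀ i, c (e i) (c x (ω (f i) y)) =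
      c x (c (e i) (ω (f i) y)) + c (c (e i) x) (ω (f i) y) := fun i => by
    rw [hc.jacobi]; abel
  have h3 : ∀ i, ω x (c (f i) y) = -ω (c (f i) y) x := fun i => hω _ _
  simp only [map_sub, map_add, h1, h2, h3, map_neg, Finset.sum_add_distrib,
    Finset.sum_sub_distrib, Finset.sum_neg_distrib, hs, infAct_apply, contraction_apply,
    ← hf]
  rw [hc.casimir e hk (ω x y)]
  simp only [map_sum, sum_apply]
  abel

end Cohomology

section Grading

variable {V : Type*} [NormedAddCommGroup V] [InnerProductSpace ℝ V]
  {ι : Type*} [Fintype ι] {Γ : Type*}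

/-- The graded pieces attached to a degree function on an orthonormal basis. -/
def piece (e : OrthonormalBasis ι ℝ V) (deg : ι → Γ) (k : Γ) : Submodule ℝ V where
  carrier := {x | ∀ i, deg i ≠ k → ⟪e i, x⟫_ℝ = 0}
  add_mem' hx hy i hi := by rw [inner_add_right, hx i hi, hy i hi, add_zero]
  zero_mem' i _ := inner_zero_right _
  smul_mem' a x hx i hi := by rw [inner_smul_right, hx i hi, mul_zero]

variable (e : OrthonormalBasis ι ℝ V) (deg : ι → Γ)

theorem mem_piece {k : Γ} {x : V} :
    x ∈ piece e deg k ↔ ∀ i, deg i ≠ k → ⟪e i, x⟫_ℝ = 0 := Iff.rfl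

theorem basis_mem_piece (i : ι) : e i ∈ piece e deg (deg i) := fun j hj => by
  classical
  rw [e.inner_eq_ite, if_neg]; rintro rfl; exact hj rfl

theorem inner_eq_zero_of_mem_piece {k l : Γ} (h : k ≠ l) {x y : V} (hx : x ∈ piece e deg k)
    (hy : y ∈ piece e deg l) : ⟪x, y⟫_ℝ = 0 := by
  rw [← e.sum_inner_mul_inner]
  refine Finset.sum_eq_zero fun i _ => ?_
  by_cases hi : deg i = k
  · rw [hy i (hi ▸ h), mul_zero]
  · rw [real_inner_comm, hx i hi, zero_mul]

variable [AddCommGroup Γ]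

/-- Endomorphisms homogeneous of degree `d`. -/
def homEnd (d : Γ) : Submodule ℝ (V →L[ℝ] V) where
  carrier := {a | ∀ k, ∀ x ∈ piece e deg k, a x ∈ piece e deg (k + d)}
  add_mem' ha hb k x hx := add_mem (ha k x hx) (hb k x hx)
  zero_mem' _ _ _ := zero_mem _
  smul_mem' t _ ha k x hx := Submodule.smul_mem _ t (ha k x hx)

/-- Skew-symmetric bilinear operations homogeneous of degree zero. -/
def skewOp :
    Submodule ℝ (V →L[ℝ] V →L[ℝ] V) where
  carrier := {c | (∀ x y, c x y = -c y x) ∧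
    ∀ k l, ∀ x ∈ piece e deg k, ∀ y ∈ piece e deg l, c x y ∈ piece e deg (k + l)}
  add_mem' ha hb := ⟨fun x y => by simp [ha.1 x y, hb.1 x y, add_comm],
    fun k l x hx y hy => add_mem (ha.2 k l x hx y hy) (hb.2 k l x hx y hy)⟩
  zero_mem' := ⟨fun x y => by simp, fun _ _ _ _ _ _ => zero_mem _⟩
  smul_mem' t _ ha := ⟨fun x y => by simp [ha.1 x y],
    fun k l x hx y hy => Submodule.smul_mem _ t (ha.2 k l x hx y hy)⟩

theorem adjoint_mem_homEnd [CompleteSpace V] {d : Γ} {a : V →L[ℝ] V} (ha : a ∈ homEnd e deg d) :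
    ContinuousLinearMap.adjoint a ∈ homEnd e deg (-d) := fun k x hx i hi => by
  rw [ContinuousLinearMap.adjoint_inner_right]
  refine inner_eq_zero_of_mem_piece e deg ?_ (ha _ _ (basis_mem_piece e deg i)) hx
  intro h; apply hi; rw [← h]; abel

theorem mul_mem_homEnd {d d' : Γ} {a b : V →L[ℝ] V} (ha : a ∈ homEnd e deg d)
    (hb : b ∈ homEnd e deg d') : a * b ∈ homEnd e deg (d + d') := fun k x hx => by
  rw [add_comm d, ← add_assoc]; exact ha _ _ (hb _ _ hx)

theorem trace_eq_zero_of_mem_homEnd {d : Γ} (hd : d ≠ 0) {a : V →L[ℝ] V}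
    (ha : a ∈ homEnd e deg d) : LinearMap.trace ℝ V (a : V →ₗ[ℝ] V) = 0 := by
  rw [LinearMap.trace_eq_sum_inner _ e]
  refine Finset.sum_eq_zero fun i _ => inner_eq_zero_of_mem_piece e deg (k := deg i)
    (l := deg i + d) ?_ (basis_mem_piece e deg i) (ha _ _ (basis_mem_piece e deg i))
  simpa using hd

variable {e deg} {c : V →L[ℝ] V →L[ℝ] V} (hc : c ∈ skewOp e deg)
include hc

theorem apply_mem_homEnd {k : Γ} {x : V} (hx : x ∈ piece e deg k) : c x ∈ homEnd e deg k :=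
  fun l y hy => by rw [add_comm]; exact hc.2 k l x hx y hy

theorem kil_eq_zero_of_mem_piece {k l : Γ} (h : k + l ≠ 0) {x y : V} (hx : x ∈ piece e deg k)
    (hy : y ∈ piece e deg l) : kil c x y = 0 :=
  trace_eq_zero_of_mem_homEnd e deg h
    (mul_mem_homEnd e deg (apply_mem_homEnd hc hx) (apply_mem_homEnd hc hy))

variable [DecidableEq ι] (hk : (kil c).Nondegenerate)

theorem dual_mem_piece (i : ι) : dual e hk i ∈ piece e deg (-deg i) := by
  classical
  set f := dual e hk i with hf
  set w : V := ∑ j, if deg j = -deg i then ⟪e j, f⟫_ℝ • e j else 0 with hw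
  have hwm : w ∈ piece e deg (-deg i) := by
    refine Submodule.sum_mem _ fun j _ => ?_
    split_ifs with hj
    · exact Submodule.smul_mem _ _ (hj ▸ basis_mem_piece e deg j)
    · exact zero_mem _
  suffices h : f = w by rw [h]; exact hwm
  rw [← sum_kil_smul_dual e hk w]
  conv_lhs => rw [← sum_kil_smul_dual e hk f]
  refine Finset.sum_congr rfl fun j _ => ?_
  congr 1
  by_cases hj : deg j = deg i
  · conv_lhs => rw [← e.sum_repr' f]
    rw [hw, map_sum, map_sum, LinearMap.sum_apply, LinearMap.sum_apply]
    refine Finset.sum_congr rfl fun l _ => ?_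
    split_ifs with hl
    · rfl
    · rw [map_smul, LinearMap.smul_apply, kil_eq_zero_of_mem_piece hc (k := deg l) (l := deg j) ?_
        (basis_mem_piece e deg l) (basis_mem_piece e deg j)]
      · simp
      · rw [hj]; exact fun h => hl (eq_neg_of_add_eq_zero_left h)
  · rw [kil_eq_zero_of_mem_piece hc (k := -deg i) ?_ hwm (basis_mem_piece e deg j), hf, kil_dual,
      if_neg]
    · rintro rfl; exact hj rfl
    · intro h; exact hj (neg_add_eq_zero.mp h).symm

theorem contraction_mem_homEnd {ω : V →L[ℝ] V →L[ℝ] V} (hω : ω ∈ skewOp e deg) :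
    contraction e hk ω ∈ homEnd e deg 0 := fun k x hx => by
  rw [contraction_apply]
  refine Submodule.sum_mem _ fun i _ => ?_
  have := hc.2 _ _ _ (basis_mem_piece e deg i) _ (hω.2 _ _ _ (dual_mem_piece hc hk i) _ hx)
  rwa [add_neg_cancel_left, ← add_zero k] at this

end Grading

section Twist

variable {V : Type*} [NormedAddCommGroup V] [InnerProductSpace ℝ V]

/-- The operation `(x, y) ↦ a (c (b x) (b y))`; for `b = a⁻¹` this is transport of structure. -/
noncomputable def twist (a b : V →L[ℝ] V) (c : V →L[ℝ] V →L[ℝ] V) : V →L[ℝ] V →L[ℝ] V :=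
  (ContinuousLinearMap.compL ℝ V V V a).comp (c.bilinearComp b b)

@[simp]
theorem twist_apply (a b : V →L[ℝ] V) (c : V →L[ℝ] V →L[ℝ] V) (x y : V) :
    twist a b c x y = a (c (b x) (b y)) := rfl

theorem twist_twist (a b a' b' : V →L[ℝ] V) (c : V →L[ℝ] V →L[ℝ] V) :
    twist a b (twist a' b' c) = twist (a * a') (b' * b) c := rfl

theorem twist_one (c : V →L[ℝ] V →L[ℝ] V) : twist 1 1 c = c := rfl

theorem hasStrictFDerivAt_triple {A C : Type*} [NormedAddCommGroup A] [NormedSpace ℝ A]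
    [NormedAddCommGroup C] [NormedSpace ℝ C] (P : A →L[ℝ] C →L[ℝ] C) (R : C →L[ℝ] A →L[ℝ] C)
    (F : C →L[ℝ] C) (E : A → A) (hE : HasStrictFDerivAt E (1 : A →L[ℝ] A) 0) (c : C) :
    ∃ Φ' : A × C →L[ℝ] C,
      (∀ S δ, Φ' (S, δ) = P S (F (R (F (R c (E 0))) (E 0))) - P (E 0) (F (R (F (R c S)) (E 0))) -
        P (E 0) (F (R (F (R c (E 0))) S)) + P (E 0) (F (R (F (R δ (E 0))) (E 0)))) ∧
      HasStrictFDerivAt (fun p : A × C => P (E p.1) (F (R (F (R p.2 (E (-p.1)))) (E (-p.1)))))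
        Φ' (0, c) := by
  have hfst := hasStrictFDerivAt_fst (𝕜 := ℝ) (E := A) (F := C) (p := (0, c))
  have hc := hasStrictFDerivAt_snd (𝕜 := ℝ) (E := A) (F := C) (p := (0, c))
  have ha := HasStrictFDerivAt.comp (f := Prod.fst) ((0 : A), c) hE hfst
  have hneg := (-(ContinuousLinearMap.fst ℝ A C)).hasStrictFDerivAt (x := (0, c))
  have hb := HasStrictFDerivAt.comp (f := fun p => -p.1) ((0 : A), c)
    (by rw [neg_zero]; exact hE) hneg
  have h1 := F.hasStrictFDerivAt.comp ((0 : A), c)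
    ((R.hasStrictFDerivAt.comp ((0 : A), c) hc).clm_apply hb)
  have h2 := F.hasStrictFDerivAt.comp ((0 : A), c)
    ((R.hasStrictFDerivAt.comp ((0 : A), c) h1).clm_apply hb)
  refine ⟨_, fun S δ => ?_, (P.hasStrictFDerivAt.comp ((0 : A), c) ha).clm_apply h2⟩
  simp
  abel

theorem hasStrictFDerivAt_twist_exp [CompleteSpace V] (c : V →L[ℝ] V →L[ℝ] V) :
    ∃ Φ' : (V →L[ℝ] V) × (V →L[ℝ] V →L[ℝ] V) →L[ℝ] (V →L[ℝ] V →L[ℝ] V),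
      (∀ S δ, Φ' (S, δ) = infAct S c + δ) ∧
      HasStrictFDerivAt (fun p : (V →L[ℝ] V) × (V →L[ℝ] V →L[ℝ] V) =>
        twist (NormedSpace.exp p.1) (NormedSpace.exp (-p.1)) p.2) Φ' (0, c) := by
  obtain ⟨Φ', h, h'⟩ := hasStrictFDerivAt_triple
    ((ContinuousLinearMap.compL ℝ V (V →L[ℝ] V) (V →L[ℝ] V)).comp
      (ContinuousLinearMap.compL ℝ V V V))
    (ContinuousLinearMap.compL ℝ V V (V →L[ℝ] V))
    (ContinuousLinearMap.flipₗᵢ ℝ V V V).toContinuousLinearEquiv.toContinuousLinearMap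
    NormedSpace.exp (hasStrictFDerivAt_exp_zero (𝕂 := ℝ) (𝔸 := V →L[ℝ] V)) c
  refine ⟨Φ', fun S δ => ?_, h'⟩
  rw [h]
  ext x y
  simp [NormedSpace.exp_zero]

theorem twist_mem_skewOp {ι : Type*} [Fintype ι] {Γ : Type*} [AddCommGroup Γ]
    {e : OrthonormalBasis ι ℝ V} {deg : ι → Γ} {a b : V →L[ℝ] V}
    {c : V →L[ℝ] V →L[ℝ] V} (ha : a ∈ homEnd e deg 0) (hb : b ∈ homEnd e deg 0)
    (hc : c ∈ skewOp e deg) : twist a b c ∈ skewOp e deg := by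
  refine ⟨fun x y => by simp only [twist_apply]; rw [hc.1, map_neg], fun k l x hx y hy => ?_⟩
  have h0 : ∀ {a : V →L[ℝ] V}, a ∈ homEnd e deg 0 → ∀ {k x}, x ∈ piece e deg k →
      a x ∈ piece e deg k := fun ha k x hx => by simpa using ha k x hx
  exact h0 ha (hc.2 _ _ _ (h0 hb hx) _ (h0 hb hy))

theorem IsBracket.transport {a b : V →L[ℝ] V} (hba : b * a = 1) {c : V →L[ℝ] V →L[ℝ] V}
    (hc : IsBracket c) : IsBracket (twist a b c) := by
  have h : ∀ x, b (a x) = x := fun x => by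
    rw [← mul_apply_eq_comp, hba, one_apply_eq_self]
  exact ⟨fun x y => by simp only [twist_apply]; rw [hc.skew, map_neg],
    fun x y z => by simp only [twist_apply, h, ← map_add]; rw [hc.jacobi]⟩

theorem exp_mem_homEnd [FiniteDimensional ℝ V] {ι : Type*} [Fintype ι] {Γ : Type*}
    [AddCommGroup Γ] {e : OrthonormalBasis ι ℝ V} {deg : ι → Γ} {a : V →L[ℝ] V}
    (ha : a ∈ homEnd e deg 0) : NormedSpace.exp a ∈ homEnd e deg 0 := by
  let A : Subalgebra ℝ (V →L[ℝ] V) :=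
    { carrier := homEnd e deg 0
      mul_mem' := fun {x y} hx hy => by
        have := mul_mem_homEnd e deg hx hy
        rwa [add_zero] at this
      add_mem' := fun {x y} hx hy => (homEnd e deg 0).add_mem hx hy
      algebraMap_mem' := fun r k x hx => by
        rw [Algebra.algebraMap_eq_smul_one, add_zero]
        exact Submodule.smul_mem _ _ hx }
  let _ : NormedAlgebra ℚ (V →L[ℝ] V) := NormedAlgebra.restrictScalars ℚ ℝ _
  have : IsScalarTower ℚ ℝ (V →L[ℝ] V) :=
    ⟨fun q r x => by rw [Rat.smul_def, mul_smul]; rfl⟩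
  exact NormedSpace.exp_mem (s := A) (Submodule.closed_of_finiteDimensional (homEnd e deg 0)) ha

theorem exp_mul_exp_neg [CompleteSpace V] (a : V →L[ℝ] V) :
    NormedSpace.exp a * NormedSpace.exp (-a) = 1 := by
  let _ : NormedAlgebra ℚ (V →L[ℝ] V) := NormedAlgebra.restrictScalars ℚ ℝ _
  rw [← NormedSpace.exp_add_of_commute (Commute.neg_right (Commute.refl a)), add_neg_cancel,
    NormedSpace.exp_zero]

end Twist

section Slice

theorem exists_eventually_eq_slice {X C : Type*} [NormedAddCommGroup X] [NormedSpace ℝ X]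
    [FiniteDimensional ℝ X] [NormedAddCommGroup C] [NormedSpace ℝ C] [FiniteDimensional ℝ C]
    (A : Submodule ℝ X) (D : Submodule ℝ C) {c : C} (hc : c ∈ D) (T : C →ₗ[ℝ] C)
    {Φ : X × C → C} {Φ' : X × C →L[ℝ] C} (hΦ : HasStrictFDerivAt Φ Φ' (0, c))
    (hΦ0 : Φ (0, c) = c) (hΦD : ∀ S ∈ A, ∀ δ ∈ D, Φ (S, δ) ∈ D) (hΦ' : ∀ δ, Φ' (0, δ) = δ)
    (hT : ∀ δ ∈ D, T δ = 0 → ∃ S ∈ A, Φ' (S, 0) = δ) :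
    ∃ K : ℝ, 0 ≤ K ∧ ∀ ε > 0, ∀ᶠ c' in 𝓝 c, c' ∈ D → ∃ S ∈ A, ∃ δ : C, ‖δ‖ < ε ∧
      ‖δ‖ ≤ K * ‖T δ‖ ∧ c' = Φ (S, c + δ) := by
  obtain ⟨W, hW⟩ := Submodule.exists_isCompl (LinearMap.ker (T.domRestrict D))
  let f : W →ₗ[ℝ] C := (T.domRestrict D).domRestrict W
  have hf : LinearMap.ker f = ⊥ := by
    refine LinearMap.ker_eq_bot'.mpr fun w hw => ?_
    have h1 : (w : D) ∈ LinearMap.ker (T.domRestrict D) ⊓ W := ⟨hw, w.2⟩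
    rw [hW.inf_eq_bot, Submodule.mem_bot] at h1
    exact Subtype.ext h1
  obtain ⟨K, -, hK⟩ := f.exists_antilipschitzWith hf
  have hK' : ∀ w : W, ‖w‖ ≤ K * ‖f w‖ := fun w => by
    simpa using hK.le_mul_dist w 0
  obtain ⟨p₀, hp₀⟩ := D.subtype.exists_leftInverse_of_injective (by simp)
  let p : C →L[ℝ] D := LinearMap.toContinuousLinearMap p₀
  have hp : ∀ ω (h : ω ∈ D), p ω = ⟨ω, h⟩ := fun ω h => LinearMap.congr_fun hp₀ ⟨ω, h⟩
  let j : A × W →L[ℝ] X × C := A.subtypeL.prodMap (D.subtypeL.comp W.subtypeL)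
  have hj : HasStrictFDerivAt (fun q : A × W => (0, c) + j q) j 0 :=
    j.hasStrictFDerivAt.const_add _
  have hΨ : HasStrictFDerivAt (fun q => p (Φ ((0, c) + j q))) (p.comp (Φ'.comp j)) 0 := by
    have h1 : HasStrictFDerivAt Φ Φ' ((0, c) + j 0) := by simpa using hΦ
    exact p.hasStrictFDerivAt.comp (0 : A × W) (h1.comp (0 : A × W) hj)
  have hsurj : (p.comp (Φ'.comp j)).range = ⊤ := by
    rw [LinearMap.range_eq_top]
    intro ω
    have h1 : ω ∈ LinearMap.ker (T.domRestrict D) ⊔ W := by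
      rw [hW.sup_eq_top]; trivial
    obtain ⟨n, hn, w, hw, rfl⟩ := Submodule.mem_sup.mp h1
    obtain ⟨S, hS, hSn⟩ := hT n n.2 hn
    refine ⟨(⟨S, hS⟩, ⟨w, hw⟩), ?_⟩
    have h2 : Φ' (S, (w : C)) = n + w := by
      rw [← hSn, ← hΦ' w, ← map_add, hΦ']; simp
    have h4 : j (⟨S, hS⟩, ⟨w, hw⟩) = (S, (w : C)) := rfl
    change p (Φ' (j _)) = _
    rw [h4, h2]
    exact hp _ (n + w).2
  have : CompleteSpace A := FiniteDimensional.complete ℝ A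
  have : CompleteSpace W := FiniteDimensional.complete ℝ W
  have : CompleteSpace D := FiniteDimensional.complete ℝ D
  have hmap := hΨ.map_nhds_eq_of_surj hsurj
  have hΨ0 : p (Φ ((0, c) + j 0)) = ⟨c, hc⟩ := by
    rw [map_zero, add_zero, hΦ0, hp c hc]
  rw [hΨ0] at hmap
  refine ⟨K, K.2, fun ε hε => ?_⟩
  have hball : {q : A × W | ‖q.2‖ < ε} ∈ 𝓝 (0 : A × W) := by
    refine (isOpen_lt (by fun_prop) continuous_const).mem_nhds ?_
    simpa using hε
  have hU := Filter.image_mem_map (m := fun q => p (Φ ((0, c) + j q))) hball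
  rw [hmap, nhds_subtype_eq_comap, Filter.mem_comap] at hU
  obtain ⟨U, hU, hUs⟩ := hU
  filter_upwards [hU] with c' hc'U hc'
  obtain ⟨q, hq, hqc⟩ := hUs (show (⟨c', hc'⟩ : D) ∈ _ from hc'U)
  have hjq : (0, c) + j q = ((q.1 : X), c + (q.2 : D)) :=
    Prod.ext (zero_add _) rfl
  refine ⟨q.1, q.1.2, (q.2 : D), hq, hK' q.2, ?_⟩
  dsimp only at hqc
  rw [hjq, hp _ (hΦD _ q.1.2 _ (D.add_mem hc (q.2 : D).2))] at hqc
  exact (congrArg Subtype.val hqc).symm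

end Slice

section Rigidity

variable {V : Type*} [NormedAddCommGroup V] [InnerProductSpace ℝ V]
  {ι : Type*} [Fintype ι] [DecidableEq ι] (e : OrthonormalBasis ι ℝ V)
  {c : V →L[ℝ] V →L[ℝ] V} (hk : (kil c).Nondegenerate)

theorem IsBracket.norm_homotopy_le (hc : IsBracket c) {δ : V →L[ℝ] V →L[ℝ] V}
    (hcδ : IsBracket (c + δ)) :
    ‖δ + infAct (contraction e hk δ) c‖ ≤
      (∑ i, ‖c (e i)‖ * (3 * ‖dual e hk i‖)) * ‖δ‖ ^ 2 := by
  have hδ : ∀ x y, δ x y = -δ y x := fun x y => by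
    have := hcδ.skew x y
    simp only [add_apply, hc.skew x y] at this
    rw [neg_add] at this
    exact add_left_cancel this
  refine ContinuousLinearMap.opNorm_le_bound₂ _ (by positivity) fun x y => ?_
  have h := hc.homotopy e hk δ hδ x y
  rw [add_apply, add_apply, h, Finset.sum_mul, Finset.sum_mul, Finset.sum_mul]
  refine (norm_sum_le _ _).trans (Finset.sum_le_sum fun i _ => ?_)
  set f := dual e hk i
  have hJ : c f (δ x y) + δ f (c x y) - c (δ f x) y - δ (c f x) y - c x (δ f y) - δ x (c f y) =
      -(δ f (δ x y)) + δ (δ f x) y + δ x (δ f y) := by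
    have h1 := hcδ.jacobi f x y
    simp only [add_apply, map_add, hc.jacobi f x y] at h1
    rw [← sub_eq_zero] at h1 ⊢
    rw [← h1]; abel
  rw [hJ]
  have hn : ∀ u v, ‖δ u v‖ ≤ ‖δ‖ * ‖u‖ * ‖v‖ := δ.le_opNorm₂
  have h1 : ‖δ f (δ x y)‖ ≤ ‖δ‖ * ‖f‖ * (‖δ‖ * ‖x‖ * ‖y‖) :=
    (hn _ _).trans (by gcongr; exact hn _ _)
  have h2 : ‖δ (δ f x) y‖ ≤ ‖δ‖ * (‖δ‖ * ‖f‖ * ‖x‖) * ‖y‖ :=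
    (hn _ _).trans (by gcongr; exact hn _ _)
  have h3 : ‖δ x (δ f y)‖ ≤ ‖δ‖ * ‖x‖ * (‖δ‖ * ‖f‖ * ‖y‖) :=
    (hn _ _).trans (by gcongr; exact hn _ _)
  have h4 : ‖-(δ f (δ x y)) + δ (δ f x) y + δ x (δ f y)‖ ≤ 3 * ‖f‖ * ‖δ‖ ^ 2 * ‖x‖ * ‖y‖ := by
    refine (norm_add₃_le).trans ?_
    rw [norm_neg]
    linarith
  calc _ ≤ ‖c (e i)‖ * (3 * ‖f‖ * ‖δ‖ ^ 2 * ‖x‖ * ‖y‖) :=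
        ((c (e i)).le_opNorm _).trans (by gcongr)
    _ = _ := by ring

variable {Γ : Type*} [AddCommGroup Γ] {deg : ι → Γ}

/-- The failure of the Casimir homotopy to trivialise a bilinear operation. -/
noncomputable def defect : (V →L[ℝ] V →L[ℝ] V) →ₗ[ℝ] (V →L[ℝ] V →L[ℝ] V) where
  toFun ω := ω + infAct (contraction e hk ω) c
  map_add' ω ω' := by
    ext x y
    simp only [add_apply, infAct_apply, contraction_apply, Finset.sum_add_distrib, map_add]
    abel
  map_smul' r ω := by
    ext x y
    simp only [add_apply, infAct_apply, contraction_apply, smul_apply, RingHom.id_apply,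
      ← Finset.smul_sum, smul_sub, smul_add, map_smul]

theorem defect_apply (ω : V →L[ℝ] V →L[ℝ] V) :
    defect e hk ω = ω + infAct (contraction e hk ω) c := rfl

theorem exists_twist_slice (hc : c ∈ skewOp e deg) :
    ∃ K : ℝ, 0 ≤ K ∧ ∀ ε > 0, ∀ᶠ c' in 𝓝 c, c' ∈ skewOp e deg → ∃ S ∈ homEnd e deg 0,
      ∃ δ : V →L[ℝ] V →L[ℝ] V, ‖δ‖ < ε ∧ ‖δ‖ ≤ K * ‖defect e hk δ‖ ∧
        c' = twist (NormedSpace.exp S) (NormedSpace.exp (-S)) (c + δ) := by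
  have : FiniteDimensional ℝ V := e.toBasis.finiteDimensional_of_finite
  have : CompleteSpace V := FiniteDimensional.complete ℝ V
  obtain ⟨Φ', hΦ', hΦ⟩ := hasStrictFDerivAt_twist_exp c
  refine exists_eventually_eq_slice (X := V →L[ℝ] V) (C := V →L[ℝ] V →L[ℝ] V)
    (homEnd e deg 0) (skewOp e deg) hc (defect e hk) hΦ ?_ ?_ ?_ ?_
  · simp only [neg_zero, NormedSpace.exp_zero]
    rfl
  · exact fun S hS δ hδ => twist_mem_skewOp (exp_mem_homEnd hS)
      (exp_mem_homEnd ((homEnd e deg 0).neg_mem hS)) hδ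
  · intro δ
    rw [hΦ']
    ext x y
    simp
  · intro ω hω h0
    refine ⟨-contraction e hk ω, (homEnd e deg 0).neg_mem (contraction_mem_homEnd hc hk hω), ?_⟩
    rw [defect_apply] at h0
    rw [hΦ']
    refine Eq.trans ?_ (eq_neg_of_add_eq_zero_left h0).symm
    ext x y
    simp only [add_apply, infAct_apply, neg_apply, map_neg, zero_apply]
    abel

theorem IsBracket.eq_zero_of_norm_le_defect (hb : IsBracket c) {δ : V →L[ℝ] V →L[ℝ] V}
    (hbr : IsBracket (c + δ)) {K M : ℝ} (hK0 : 0 ≤ K) (hM0 : 0 ≤ M)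
    (hM : ∑ i, ‖c (e i)‖ * (3 * ‖dual e hk i‖) ≤ M)
    (hδε : ‖δ‖ < 1 / (K * M + 1)) (hδ : ‖δ‖ ≤ K * ‖defect e hk δ‖) : δ = 0 := by
  have hle : ‖defect e hk δ‖ ≤ M * ‖δ‖ ^ 2 :=
    (hb.norm_homotopy_le e hk hbr).trans (by gcongr)
  by_contra h0
  have hpos : 0 < ‖δ‖ := (norm_pos_iff (E := V →L[ℝ] V →L[ℝ] V)).mpr h0
  have h3 : ‖δ‖ ≤ K * (M * ‖δ‖ ^ 2) := hδ.trans (by gcongr)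
  rw [lt_div_iff₀ (by positivity)] at hδε
  nlinarith

theorem IsBracket.eventually_exists_twist (hb : IsBracket c) (hc : c ∈ skewOp e deg)
    (hk : (kil c).Nondegenerate) :
    ∀ᶠ c' in 𝓝 c, c' ∈ skewOp e deg → IsBracket c' →
      ∃ a b : V →L[ℝ] V, a ∈ homEnd e deg 0 ∧ b ∈ homEnd e deg 0 ∧ a * b = 1 ∧ b * a = 1 ∧
        c' = twist a b c := by
  have : FiniteDimensional ℝ V := e.toBasis.finiteDimensional_of_finite
  have : CompleteSpace V := FiniteDimensional.complete ℝ V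
  obtain ⟨K, hK0, hK⟩ := exists_twist_slice e hk hc
  obtain ⟨M, hM⟩ : ∃ M, M = ∑ i, ‖c (e i)‖ * (3 * ‖dual e hk i‖) := ⟨_, rfl⟩
  have hM0 : 0 ≤ M := by rw [hM]; positivity
  filter_upwards [hK (1 / (K * M + 1)) (by positivity)] with c' hc' hcs hb'
  obtain ⟨S, hS, δ, hδε, hδ, hcc⟩ := hc' hcs
  have ha := exp_mem_homEnd hS
  have ha' := exp_mem_homEnd ((homEnd e deg 0).neg_mem hS)
  have hinv := exp_mul_exp_neg S
  have hinv' := exp_mul_exp_neg (-S)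
  rw [neg_neg] at hinv'
  generalize NormedSpace.exp S = a at *
  generalize NormedSpace.exp (-S) = b at *
  have h1 : twist b a c' = c + δ := by
    rw [hcc, twist_twist, hinv', twist_one]
  have hbr : IsBracket (c + δ) := by
    rw [← h1]
    exact hb'.transport hinv
  have hδ0 := hb.eq_zero_of_norm_le_defect e hk hbr hK0 hM0 hM.ge hδε hδ
  exact ⟨a, b, ha, ha', hinv, hinv', by rw [hcc, hδ0, add_zero]⟩

end Rigidity

section Determinant

theorem hasDerivAt_det_one_add_smul {n : Type*} [Fintype n] [DecidableEq n] (M : Matrix n n ℝ) :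
    HasDerivAt (fun t : ℝ => (1 + t • M).det) M.trace 0 := by
  have h : (fun t : ℝ => (1 + t • M).det) = fun t =>
      1 + M.trace * t + ((1 + (Polynomial.X : Polynomial ℝ) •
        M.map Polynomial.C).det.divX.divX.eval t) * t ^ 2 := by
    funext t
    exact Matrix.det_one_add_smul t M
  rw [h]
  have h1 := ((hasDerivAt_id (0 : ℝ)).const_mul M.trace).const_add 1
  have h2 := ((1 + (Polynomial.X : Polynomial ℝ) •
        M.map Polynomial.C).det.divX.divX.hasDerivAt 0).mul (hasDerivAt_pow 2 (0 : ℝ))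
  refine (h1.add h2).congr_deriv ?_
  simp

theorem det_exp_eq_one {V : Type*} [NormedAddCommGroup V] [InnerProductSpace ℝ V]
    [FiniteDimensional ℝ V] {S : V →L[ℝ] V} (hS : LinearMap.trace ℝ V (S : V →ₗ[ℝ] V) = 0) :
    LinearMap.det ((NormedSpace.exp S : V →L[ℝ] V) : V →ₗ[ℝ] V) = 1 := by
  have : CompleteSpace V := FiniteDimensional.complete ℝ V
  let b := stdOrthonormalBasis ℝ V
  let D : (V →L[ℝ] V) → ℝ := fun A => LinearMap.det (A : V →ₗ[ℝ] V)
  let M₀ : (V →L[ℝ] V) →ₗ[ℝ] Matrix _ _ ℝ :=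
    (LinearMap.toMatrix b.toBasis b.toBasis).toLinearMap ∘ₗ ContinuousLinearMap.coeLM ℝ
  have hD : ∀ A, D A = (M₀ A).det := fun A => (LinearMap.det_toMatrix b.toBasis _).symm
  have hdiff : Differentiable ℝ D := by
    have h1 : ∀ i j, Differentiable ℝ fun A => M₀ A i j := fun i j =>
      (LinearMap.toContinuousLinearMap
        ((Matrix.entryLinearMap ℝ ℝ i j).comp M₀)).differentiable
    have h2 : D = fun A => (M₀ A).det := funext hD
    rw [h2]
    simp only [Matrix.det_apply]
    fun_prop
  have hline : HasDerivAt (fun t : ℝ => D (1 + t • S)) 0 0 := by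
    have h1 : (fun t : ℝ => D (1 + t • S)) = fun t => (1 + t • M₀ S).det := by
      funext t
      rw [hD, map_add, map_smul]
      congr 2
      exact LinearMap.toMatrix_one b.toBasis
    have h2 : (M₀ S).trace = 0 := by
      rw [← hS, LinearMap.trace_eq_matrix_trace ℝ b.toBasis]; rfl
    have h3 := hasDerivAt_det_one_add_smul (M₀ S)
    rw [h1]
    rwa [h2] at h3
  have hfd : fderiv ℝ D 1 S = 0 := by
    have h1 : HasDerivAt (fun t : ℝ => (1 : V →L[ℝ] V) + t • S) S 0 := by
      simpa using ((hasDerivAt_id (0 : ℝ)).smul_const S).const_add (1 : V →L[ℝ] V)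
    have h2 : HasFDerivAt D (fderiv ℝ D 1) ((1 : V →L[ℝ] V) + (0 : ℝ) • S) := by
      rw [zero_smul, add_zero]; exact (hdiff 1).hasFDerivAt
    have h3 := h2.comp_hasDerivAt (0 : ℝ) h1
    exact h3.unique hline
  have hexp0 : HasDerivAt (fun t : ℝ => D (NormedSpace.exp (t • S))) 0 0 := by
    have h1 := hasDerivAt_exp_smul_const (𝕂 := ℝ) S (0 : ℝ)
    have h2 : HasFDerivAt D (fderiv ℝ D 1) (NormedSpace.exp ((0 : ℝ) • S)) := by
      rw [zero_smul, NormedSpace.exp_zero]; exact (hdiff 1).hasFDerivAt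
    have h3 := h2.comp_hasDerivAt (0 : ℝ) h1
    rw [zero_smul, NormedSpace.exp_zero, one_mul, hfd] at h3
    exact h3
  let _ : NormedAlgebra ℚ (V →L[ℝ] V) := NormedAlgebra.restrictScalars ℚ ℝ _
  have hmul : ∀ s t : ℝ, D (NormedSpace.exp ((s + t) • S)) =
      D (NormedSpace.exp (s • S)) * D (NormedSpace.exp (t • S)) := fun s t => by
    rw [add_smul, NormedSpace.exp_add_of_commute
      (((Commute.refl S).smul_left s).smul_right t)]
    exact LinearMap.det_comp _ _
  have hderiv : ∀ t : ℝ, HasDerivAt (fun t : ℝ => D (NormedSpace.exp (t • S))) 0 t := fun t => by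
    have h1 : HasDerivAt (fun s : ℝ => D (NormedSpace.exp ((s - t) • S))) 0 t := by
      have := HasDerivAt.comp_sub_const (f := fun t : ℝ => D (NormedSpace.exp (t • S)))
        (f' := 0) t t (by rw [sub_self]; exact hexp0)
      exact this
    have h2 := h1.const_mul (D (NormedSpace.exp (t • S)))
    simp only [← hmul, add_sub_cancel, mul_zero] at h2
    exact h2
  have hconst := is_const_of_deriv_eq_zero (fun t => (hderiv t).differentiableAt)
    (fun t => (hderiv t).deriv) 1 0
  simp only [one_smul, zero_smul, NormedSpace.exp_zero] at hconst
  exact hconst.trans LinearMap.det_id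

end Determinant

section FirstVariation

theorem sum_inner_eq_zero_of_forall_le {A C V : Type*} [NormedAddCommGroup A] [NormedSpace ℝ A]
    [NormedAddCommGroup C] [NormedSpace ℝ C] [NormedAddCommGroup V] [InnerProductSpace ℝ V]
    [FiniteDimensional ℝ C] {ι : Type*} [Fintype ι] (l : ι → ι → C →ₗ[ℝ] V)
    {Φ : A × C → C} {Φ' : A × C →L[ℝ] C} {c : C}
    (hΦ : HasStrictFDerivAt Φ Φ' (0, c)) (hΦ0 : Φ (0, c) = c) {S : A}
    (hmin : ∀ t : ℝ, ∑ i, ∑ j, ‖l i j c‖ ^ 2 ≤ ∑ i, ∑ j, ‖l i j (Φ (t • S, c))‖ ^ 2) :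
    ∑ i, ∑ j, ⟪l i j (Φ' (S, 0)), l i j c⟫_ℝ = 0 := by
  have hl : HasDerivAt (fun t : ℝ => (t • S, c)) (S, 0) 0 := by
    have h1 : HasDerivAt (fun t : ℝ => t • S) S 0 := by
      simpa using (hasDerivAt_id (0 : ℝ)).smul_const S
    exact h1.prodMk (hasDerivAt_const (0 : ℝ) c)
  have hγ : HasDerivAt (fun t : ℝ => Φ (t • S, c)) (Φ' (S, 0)) 0 := by
    have h1 : HasFDerivAt Φ Φ' ((0 : ℝ) • S, c) := by
      rw [zero_smul]; exact hΦ.hasFDerivAt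
    exact h1.comp_hasDerivAt (0 : ℝ) hl
  have hγ0 : Φ ((0 : ℝ) • S, c) = c := by rw [zero_smul, hΦ0]
  have hE : HasDerivAt (fun t : ℝ => ∑ i, ∑ j, ‖l i j (Φ (t • S, c))‖ ^ 2)
      (∑ i, ∑ j, 2 * ⟪l i j (Φ ((0 : ℝ) • S, c)), l i j (Φ' (S, 0))⟫_ℝ) 0 :=
    HasDerivAt.fun_sum fun i _ => HasDerivAt.fun_sum fun j _ =>
      ((l i j).toContinuousLinearMap.hasFDerivAt.comp_hasDerivAt (0 : ℝ) hγ).norm_sq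
  have hlm : IsLocalMin (fun t : ℝ => ∑ i, ∑ j, ‖l i j (Φ (t • S, c))‖ ^ 2) 0 :=
    Filter.Eventually.of_forall fun t => by
      simp only [hγ0]
      exact hmin t
  have h := hlm.hasDerivAt_eq_zero hE
  simp only [hγ0, ← Finset.mul_sum] at h
  simp only [real_inner_comm (l _ _ c)]
  linarith

theorem exists_forall_le_of_norm_le {C : Type*} [NormedAddCommGroup C] [NormedSpace ℝ C]
    [FiniteDimensional ℝ C] {E : C → ℝ} (hE : Continuous E) {M : ℝ} (hM : 0 ≤ M)
    (h : ∀ c, ‖c‖ ≤ M * (1 + E c)) {O : Set C} (hO : IsClosed O) (hne : O.Nonempty) :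
    ∃ c ∈ O, ∀ c' ∈ O, E c ≤ E c' := by
  have : ProperSpace C := FiniteDimensional.proper ℝ C
  obtain ⟨c₀, hc₀⟩ := hne
  have hcl : IsClosed (O ∩ {c | E c ≤ E c₀}) := hO.inter (isClosed_le hE continuous_const)
  have hbd : Bornology.IsBounded (O ∩ {c | E c ≤ E c₀}) := by
    rw [isBounded_iff_forall_norm_le]
    refine ⟨M * (1 + E c₀), fun c hc => (h c).trans ?_⟩
    have := hc.2
    simp only [Set.mem_ofPred_eq] at this
    gcongr
  obtain ⟨c, hc, hmin⟩ := (Metric.isCompact_of_isClosed_isBounded hcl hbd).exists_isMinOn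
    ⟨c₀, hc₀, le_refl (E c₀)⟩ hE.continuousOn
  refine ⟨c, hc.1, fun c' hc' => ?_⟩
  by_cases h : E c' ≤ E c₀
  · exact hmin ⟨hc', h⟩
  · exact hc.2.trans (not_le.mp h).le

end FirstVariation

section Orbit

variable {V : Type*} [NormedAddCommGroup V] [InnerProductSpace ℝ V]
  {ι : Type*} [Fintype ι] {Γ : Type*} [AddCommGroup Γ]
  (e : OrthonormalBasis ι ℝ V) (deg : ι → Γ)

/-- The orbit of a bilinear operation under degree-preserving automorphisms of determinant one. -/
def orbit (c : V →L[ℝ] V →L[ℝ] V) : Set (V →L[ℝ] V →L[ℝ] V) :=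
  {c' | ∃ a b : V →L[ℝ] V, a ∈ homEnd e deg 0 ∧ b ∈ homEnd e deg 0 ∧ a * b = 1 ∧ b * a = 1 ∧
    LinearMap.det (a : V →ₗ[ℝ] V) = 1 ∧ c' = twist a b c}

/-- The squared Hilbert–Schmidt norm of a bilinear operation. -/
noncomputable def energy (c : V →L[ℝ] V →L[ℝ] V) : ℝ := ∑ i, ∑ j, ‖c (e i) (e j)‖ ^ 2

theorem continuous_energy : Continuous (energy e) := by
  unfold energy; fun_prop

theorem norm_apply_le_energy (c : V →L[ℝ] V →L[ℝ] V) (i j : ι) :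
    ‖c (e i) (e j)‖ ≤ 1 + energy e c := by
  have h1 : ‖c (e i) (e j)‖ ^ 2 ≤ energy e c :=
    (Finset.single_le_sum (f := fun j => ‖c (e i) (e j)‖ ^ 2) (fun _ _ => by positivity)
      (Finset.mem_univ j)).trans
    (Finset.single_le_sum (f := fun i => ∑ j, ‖c (e i) (e j)‖ ^ 2) (fun _ _ => by positivity)
      (Finset.mem_univ i))
  nlinarith [sq_nonneg (‖c (e i) (e j)‖ - 1)]

theorem norm_le_energy (c : V →L[ℝ] V →L[ℝ] V) :
    ‖c‖ ≤ (∑ _i : ι, ∑ _j : ι, (1 : ℝ)) * (1 + energy e c) := by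
  have hE : 0 ≤ energy e c := by unfold energy; positivity
  refine ContinuousLinearMap.opNorm_le_bound₂ _ (by positivity) fun x y => ?_
  conv_lhs => rw [← e.sum_repr' x, ← e.sum_repr' y]
  simp only [map_sum, sum_apply, map_smul, smul_apply]
  rw [Finset.sum_mul, Finset.sum_mul, Finset.sum_mul]
  refine (norm_sum_le _ _).trans (Finset.sum_le_sum fun j _ => ?_)
  rw [Finset.sum_mul, Finset.sum_mul, Finset.sum_mul, Finset.smul_sum]
  refine (norm_sum_le _ _).trans (Finset.sum_le_sum fun i _ => ?_)
  have hx : ‖⟪e i, x⟫_ℝ‖ ≤ ‖x‖ := by simpa using norm_inner_le_norm (𝕜 := ℝ) (e i) x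
  have hy : ‖⟪e j, y⟫_ℝ‖ ≤ ‖y‖ := by simpa using norm_inner_le_norm (𝕜 := ℝ) (e j) y
  have h := norm_apply_le_energy e c i j
  rw [norm_smul, norm_smul]
  calc _ ≤ ‖y‖ * (‖x‖ * (1 + energy e c)) := by gcongr
    _ = _ := by ring

theorem exists_isMinOn_energy {O : Set (V →L[ℝ] V →L[ℝ] V)} (hO : IsClosed O)
    (hne : O.Nonempty) : ∃ c ∈ O, ∀ c' ∈ O, energy e c ≤ energy e c' := by
  have : FiniteDimensional ℝ V := e.toBasis.finiteDimensional_of_finite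
  exact exists_forall_le_of_norm_le (C := V →L[ℝ] V →L[ℝ] V) (continuous_energy e) (by positivity)
    (norm_le_energy e) hO hne

variable {e deg}

theorem mem_orbit_self (c : V →L[ℝ] V →L[ℝ] V) : c ∈ orbit e deg c :=
  have h1 : (1 : V →L[ℝ] V) ∈ homEnd e deg 0 := fun k x hx => by rwa [add_zero]
  ⟨1, 1, h1, h1, one_mul 1, one_mul 1, LinearMap.det_id, (twist_one c).symm⟩

theorem continuous_twist [FiniteDimensional ℝ V] (a b : V →L[ℝ] V) : Continuous (twist a b) := by
  let f : (V →L[ℝ] V →L[ℝ] V) →ₗ[ℝ] (V →L[ℝ] V →L[ℝ] V) :=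
    { toFun := twist a b
      map_add' := fun c c' => by ext x y; simp
      map_smul' := fun r c => by ext x y; simp }
  exact f.continuous_of_finiteDimensional

theorem twist_mem_closure_orbit {a b : V →L[ℝ] V} (ha : a ∈ homEnd e deg 0)
    (hb : b ∈ homEnd e deg 0) (hab : a * b = 1) (hba : b * a = 1)
    (hdet : LinearMap.det (a : V →ₗ[ℝ] V) = 1) {c c' : V →L[ℝ] V →L[ℝ] V}
    (hc' : c' ∈ closure (orbit e deg c)) : twist a b c' ∈ closure (orbit e deg c) := by
  have h0 : ∀ {a b : V →L[ℝ] V}, a ∈ homEnd e deg 0 → b ∈ homEnd e deg 0 →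
      a * b ∈ homEnd e deg 0 := fun ha hb => by simpa using mul_mem_homEnd e deg ha hb
  have : FiniteDimensional ℝ V := e.toBasis.finiteDimensional_of_finite
  refine map_mem_closure (continuous_twist a b) hc' ?_
  rintro _ ⟨a', b', ha', hb', hab', hba', hdet', rfl⟩
  refine ⟨a * a', b' * b, h0 ha ha', h0 hb' hb, ?_, ?_, ?_, twist_twist ..⟩
  · rw [mul_assoc, ← mul_assoc a', hab', one_mul, hab]
  · rw [mul_assoc, ← mul_assoc b, hba, one_mul, hba']
  · exact (LinearMap.det_comp _ _).trans (by rw [hdet, hdet', one_mul])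

theorem mem_skewOp_of_mem_closure {c c' : V →L[ℝ] V →L[ℝ] V} (hc : c ∈ skewOp e deg)
    (hc' : c' ∈ closure (orbit e deg c)) : c' ∈ skewOp e deg := by
  have : FiniteDimensional ℝ V := e.toBasis.finiteDimensional_of_finite
  refine closure_minimal ?_ (Submodule.closed_of_finiteDimensional (skewOp e deg)) hc'
  rintro _ ⟨a, b, ha, hb, -, -, -, rfl⟩
  exact twist_mem_skewOp ha hb hc

theorem isClosed_setOf_isBracket : IsClosed {c : V →L[ℝ] V →L[ℝ] V | IsBracket c} := by
  have h : {c : V →L[ℝ] V →L[ℝ] V | IsBracket c} =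
      {c | ∀ x y, c x y = -c y x} ∩
        {c | ∀ x y z, c x (c y z) = c (c x y) z + c y (c x z)} :=
    Set.ext fun c => ⟨fun h => ⟨h.skew, h.jacobi⟩, fun h => ⟨h.1, h.2⟩⟩
  rw [h]
  refine IsClosed.inter ?_ ?_
  · simp only [Set.ofPred_forall]
    exact isClosed_iInter fun x => isClosed_iInter fun y => isClosed_eq (by fun_prop) (by fun_prop)
  · simp only [Set.ofPred_forall]
    exact isClosed_iInter fun x => isClosed_iInter fun y => isClosed_iInter fun z =>
      isClosed_eq (by fun_prop) (by fun_prop)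

theorem isBracket_of_mem_closure {c c' : V →L[ℝ] V →L[ℝ] V} (hc : IsBracket c)
    (hc' : c' ∈ closure (orbit e deg c)) : IsBracket c' := by
  refine closure_minimal ?_ isClosed_setOf_isBracket hc'
  rintro _ ⟨a, b, -, -, -, hba, -, rfl⟩
  exact hc.transport hba

theorem kil_twist {a b : V →L[ℝ] V} (hba : b * a = 1) (c : V →L[ℝ] V →L[ℝ] V) (x y : V) :
    kil (twist a b c) x y = kil c (b x) (b y) := by
  have h : ∀ x, ((twist a b c x : V →L[ℝ] V) : V →ₗ[ℝ] V) =
      (a : V →ₗ[ℝ] V) * ((c (b x) : V →ₗ[ℝ] V) * (b : V →ₗ[ℝ] V)) := fun x => rfl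
  have hba' : (b : V →ₗ[ℝ] V) * (a : V →ₗ[ℝ] V) = 1 :=
    congrArg (fun f : V →L[ℝ] V => (f : V →ₗ[ℝ] V)) hba
  have h2 : ∀ X Y : V →ₗ[ℝ] V, (a : V →ₗ[ℝ] V) * (X * (b : V →ₗ[ℝ] V)) *
      ((a : V →ₗ[ℝ] V) * (Y * (b : V →ₗ[ℝ] V))) =
        (a : V →ₗ[ℝ] V) * (X * Y * (b : V →ₗ[ℝ] V)) := fun X Y => by
    rw [mul_assoc, mul_assoc X, ← mul_assoc (b : V →ₗ[ℝ] V), hba', one_mul, mul_assoc X]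
  rw [kil_apply, kil_apply, h, h, ← Module.End.mul_eq_comp, ← Module.End.mul_eq_comp, h2,
    LinearMap.trace_mul_comm, mul_assoc, hba', mul_one]

theorem continuous_kil (e : OrthonormalBasis ι ℝ V) (x y : V) :
    Continuous fun c : V →L[ℝ] V →L[ℝ] V => kil c x y := by
  have h : ∀ c : V →L[ℝ] V →L[ℝ] V, kil c x y = ∑ i, ⟪e i, c x (c y (e i))⟫_ℝ := fun c => by
    rw [kil_apply, LinearMap.trace_eq_sum_inner _ e]; rfl
  simp only [h]
  fun_prop

theorem nondegenerate_of_mem_closure [DecidableEq ι] {c c' : V →L[ℝ] V →L[ℝ] V}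
    (hk : (kil c).Nondegenerate)
    (hc' : c' ∈ closure (orbit e deg c)) : (kil c').Nondegenerate := by
  rw [LinearMap.BilinForm.nondegenerate_iff_det_ne_zero e.toBasis] at hk ⊢
  suffices h : (LinearMap.BilinForm.toMatrix e.toBasis (kil c')).det =
      (LinearMap.BilinForm.toMatrix e.toBasis (kil c)).det by rwa [h]
  have hcl : IsClosed {c' : V →L[ℝ] V →L[ℝ] V |
      (LinearMap.BilinForm.toMatrix e.toBasis (kil c')).det =
        (LinearMap.BilinForm.toMatrix e.toBasis (kil c)).det} := by
    refine isClosed_eq (Continuous.matrix_det ?_) continuous_const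
    refine continuous_matrix fun i j => ?_
    simp only [LinearMap.BilinForm.toMatrix_apply]
    exact continuous_kil e _ _
  refine closure_minimal ?_ hcl hc'
  rintro _ ⟨a, b, -, -, -, hba, hdet, rfl⟩
  have h1 : kil (twist a b c) = (kil c).comp (b : V →ₗ[ℝ] V) (b : V →ₗ[ℝ] V) :=
    LinearMap.ext₂ fun x y => kil_twist hba c x y
  have h2 : LinearMap.det (b : V →ₗ[ℝ] V) = 1 := by
    have h3 : LinearMap.det (b : V →ₗ[ℝ] V) * LinearMap.det (a : V →ₗ[ℝ] V) = 1 := by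
      rw [← LinearMap.det_comp, ← ContinuousLinearMap.toLinearMap_comp]
      exact (congrArg (fun f : V →L[ℝ] V => LinearMap.det (f : V →ₗ[ℝ] V)) hba).trans
        LinearMap.det_id
    rwa [hdet, mul_one] at h3
  rw [Set.mem_ofPred_eq, h1, LinearMap.BilinForm.toMatrix_comp e.toBasis e.toBasis, Matrix.det_mul,
    Matrix.det_mul, Matrix.det_transpose, LinearMap.det_toMatrix, h2, one_mul, mul_one]

theorem sum_inner_infAct_eq_zero {c : V →L[ℝ] V →L[ℝ] V} {O : Set (V →L[ℝ] V →L[ℝ] V)}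
    (hmin : ∀ c' ∈ O, energy e c ≤ energy e c') {S : V →L[ℝ] V}
    (hS : ∀ t : ℝ, twist (NormedSpace.exp (t • S)) (NormedSpace.exp (-(t • S))) c ∈ O) :
    ∑ i, ∑ j, ⟪infAct S c (e i) (e j), c (e i) (e j)⟫_ℝ = 0 := by
  have : FiniteDimensional ℝ V := e.toBasis.finiteDimensional_of_finite
  have : CompleteSpace V := FiniteDimensional.complete ℝ V
  obtain ⟨Φ', hΦ', hΦ⟩ := hasStrictFDerivAt_twist_exp c
  obtain ⟨l, hl⟩ : ∃ l : ι → ι → (V →L[ℝ] V →L[ℝ] V) →ₗ[ℝ] V,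
      ∀ i j c, l i j c = c (e i) (e j) :=
    ⟨fun i j =>
      { toFun := fun c => c (e i) (e j)
        map_add' := fun _ _ => rfl
        map_smul' := fun _ _ => rfl }, fun _ _ _ => rfl⟩
  have h0 : twist (NormedSpace.exp (0 : V →L[ℝ] V)) (NormedSpace.exp (-0)) c = c := by
    rw [neg_zero, NormedSpace.exp_zero, twist_one]
  have hle : ∀ t : ℝ, ∑ i, ∑ j, ‖l i j c‖ ^ 2 ≤ ∑ i, ∑ j,
      ‖l i j (twist (NormedSpace.exp (t • S)) (NormedSpace.exp (-(t • S))) c)‖ ^ 2 :=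
    fun t => by
      simp only [hl]
      exact hmin _ (hS t)
  have h1 := @sum_inner_eq_zero_of_forall_le (V →L[ℝ] V) (V →L[ℝ] V →L[ℝ] V) V _ _ _ _ _ _
    inferInstance ι _ l
  have h := h1 hΦ h0 hle
  simpa only [hΦ', add_zero, hl] using h

/-- A minimal bracket in the closure of the orbit of a nondegenerate graded bracket. -/
theorem IsBracket.exists_critical [DecidableEq ι] {c : V →L[ℝ] V →L[ℝ] V} (hb : IsBracket c)
    (hc : c ∈ skewOp e deg) (hk : (kil c).Nondegenerate) :
    ∃ c' ∈ closure (orbit e deg c), IsBracket c' ∧ c' ∈ skewOp e deg ∧ (kil c').Nondegenerate ∧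
      ∀ S ∈ homEnd e deg 0, LinearMap.trace ℝ V (S : V →ₗ[ℝ] V) = 0 →
        ∑ i, ∑ j, ⟪infAct S c' (e i) (e j), c' (e i) (e j)⟫_ℝ = 0 := by
  have : FiniteDimensional ℝ V := e.toBasis.finiteDimensional_of_finite
  have : CompleteSpace V := FiniteDimensional.complete ℝ V
  obtain ⟨c', hc', hmin⟩ := exists_isMinOn_energy e (isClosed_closure (s := orbit e deg c))
    ⟨c, subset_closure (mem_orbit_self c)⟩
  refine ⟨c', hc', isBracket_of_mem_closure hb hc', mem_skewOp_of_mem_closure hc hc',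
    nondegenerate_of_mem_closure hk hc', fun S hS htr => ?_⟩
  refine sum_inner_infAct_eq_zero hmin fun t => ?_
  have htS : t • S ∈ homEnd e deg 0 := (homEnd e deg 0).smul_mem t hS
  have h2 := exp_mul_exp_neg (-(t • S))
  rw [neg_neg] at h2
  refine twist_mem_closure_orbit (exp_mem_homEnd htS)
    (exp_mem_homEnd ((homEnd e deg 0).neg_mem htS)) (exp_mul_exp_neg _) h2 (det_exp_eq_one ?_) hc'
  rw [ContinuousLinearMap.toLinearMap_smul, map_smul, htr, smul_zero]

end Orbit

section Critical

open ContinuousLinearMap (adjoint)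

variable {V : Type*} [NormedAddCommGroup V] [InnerProductSpace ℝ V]

theorem infAct_commutator (A B : V →L[ℝ] V) (c : V →L[ℝ] V →L[ℝ] V) :
    infAct (A * B - B * A) c = infAct A (infAct B c) - infAct B (infAct A c) := by
  ext x y
  simp only [infAct_apply, sub_apply, mul_apply_eq_comp, map_sub]
  abel

theorem IsBracket.infAct_eq_zero {c : V →L[ℝ] V →L[ℝ] V} (hc : IsBracket c) (x : V) :
    infAct (c x) c = 0 := by
  ext y z
  simp only [infAct_apply, zero_apply]
  rw [hc.jacobi x y z]
  abel

variable {ι : Type*} [Fintype ι] (e : OrthonormalBasis ι ℝ V)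

theorem sum_inner_adjoint [CompleteSpace V] (p q : V →L[ℝ] V) (S : V →L[ℝ] V) :
    ∑ i, ⟪p (S (e i)), q (e i)⟫_ℝ = ∑ i, ⟪p (e i), q (adjoint S (e i))⟫_ℝ := by
  have h1 : ∀ i, p (S (e i)) = ∑ j, ⟪e j, S (e i)⟫_ℝ • p (e j) := fun i => by
    conv_lhs => rw [← e.sum_repr' (S (e i))]
    simp
  have h2 : ∀ i, q (adjoint S (e i)) = ∑ j, ⟪e i, S (e j)⟫_ℝ • q (e j) := fun i => by
    conv_lhs => rw [← e.sum_repr' (adjoint S (e i))]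
    simp [ContinuousLinearMap.adjoint_inner_right, real_inner_comm]
  simp only [h1, h2, sum_inner, inner_sum, inner_smul_left, inner_smul_right, conj_trivial]
  exact Finset.sum_comm

/-- The Hilbert–Schmidt inner product of bilinear operations. -/
noncomputable def hsInner (c c' : V →L[ℝ] V →L[ℝ] V) : ℝ :=
  ∑ i, ∑ j, ⟪c (e i) (e j), c' (e i) (e j)⟫_ℝ

theorem hsInner_infAct [CompleteSpace V] (S : V →L[ℝ] V) (c c' : V →L[ℝ] V →L[ℝ] V) :
    hsInner e (infAct S c) c' = hsInner e c (infAct (adjoint S) c') := by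
  simp only [hsInner, infAct_apply, inner_sub_left, inner_sub_right, Finset.sum_sub_distrib,
    ContinuousLinearMap.adjoint_inner_right]
  congr 1
  · congr 1
    rw [Finset.sum_comm, Finset.sum_comm (f := fun i j => ⟪c (e i) (e j), _⟫_ℝ)]
    exact Finset.sum_congr rfl fun j _ => sum_inner_adjoint e (c.flip (e j)) (c'.flip (e j)) S
  · exact Finset.sum_congr rfl fun i _ => sum_inner_adjoint e (c (e i)) (c' (e i)) S

theorem eq_zero_of_hsInner_self_eq_zero {c : V →L[ℝ] V →L[ℝ] V} (h : hsInner e c c = 0) :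
    c = 0 := by
  have h1 : ∀ i j, c (e i) (e j) = 0 := fun i j => by
    have h2 := (Finset.sum_eq_zero_iff_of_nonneg fun i _ =>
      Finset.sum_nonneg fun j _ => real_inner_self_nonneg).mp h i (Finset.mem_univ i)
    have h3 := (Finset.sum_eq_zero_iff_of_nonneg fun j _ =>
      real_inner_self_nonneg).mp h2 j (Finset.mem_univ j)
    exact inner_self_eq_zero.mp h3
  ext x y
  rw [← e.sum_repr' x, ← e.sum_repr' y]
  simp [sum_apply, h1]

variable {Γ : Type*} [AddCommGroup Γ] (deg : ι → Γ)

/-- The first-order condition for minimality under degree-preserving volume-preserving maps. -/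
def IsCritical (c : V →L[ℝ] V →L[ℝ] V) : Prop :=
  ∀ S ∈ homEnd e deg 0, LinearMap.trace ℝ V (S : V →ₗ[ℝ] V) = 0 → hsInner e (infAct S c) c = 0

variable {e deg} {c : V →L[ℝ] V →L[ℝ] V}

theorem IsCritical.infAct_adjoint_eq_zero [CompleteSpace V] (hcr : IsCritical e deg c)
    {A : V →L[ℝ] V} {k : Γ} (hA : A ∈ homEnd e deg k) (h : infAct A c = 0) :
    infAct (adjoint A) c = 0 := by
  have hA' := adjoint_mem_homEnd e deg hA
  have h1 : A * adjoint A - adjoint A * A ∈ homEnd e deg 0 := by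
    have h2 := mul_mem_homEnd e deg hA hA'
    have h3 := mul_mem_homEnd e deg hA' hA
    rw [add_neg_cancel] at h2
    rw [neg_add_cancel] at h3
    exact (homEnd e deg 0).sub_mem h2 h3
  have h2 : LinearMap.trace ℝ V ((A * adjoint A - adjoint A * A : V →L[ℝ] V) : V →ₗ[ℝ] V) = 0 := by
    have h3 : ((A * adjoint A - adjoint A * A : V →L[ℝ] V) : V →ₗ[ℝ] V) =
        (A : V →ₗ[ℝ] V) * (adjoint A : V →L[ℝ] V) -
          ((adjoint A : V →L[ℝ] V) : V →ₗ[ℝ] V) * (A : V →ₗ[ℝ] V) := rfl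
    rw [h3, map_sub, LinearMap.trace_mul_comm, sub_self]
  have h3 := hcr _ h1 h2
  have h0 : infAct (adjoint A) (0 : V →L[ℝ] V →L[ℝ] V) = 0 := by ext x y; simp
  rw [infAct_commutator, h, h0, sub_zero, hsInner_infAct] at h3
  exact eq_zero_of_hsInner_self_eq_zero e h3

/-- A Cartan involution of a bracket which reverses the gradation. -/
structure IsReversing (e : OrthonormalBasis ι ℝ V) (deg : ι → Γ) (c : V →L[ℝ] V →L[ℝ] V)
    (θ : V →ₗ[ℝ] V) : Prop where
  involutive : ∀ x, θ (θ x) = x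
  map_bracket : ∀ x y, θ (c x y) = c (θ x) (θ y)
  map_piece : ∀ k, ∀ x ∈ piece e deg k, θ x ∈ piece e deg (-k)
  pos : ∀ x, x ≠ 0 → 0 < -kil c x (θ x)

theorem IsReversing.transport {a b : V →L[ℝ] V} (ha : a ∈ homEnd e deg 0)
    (hb : b ∈ homEnd e deg 0) (hab : a * b = 1) (hba : b * a = 1) {θ : V →ₗ[ℝ] V}
    (h : IsReversing e deg (twist a b c) θ) :
    IsReversing e deg c ((b : V →ₗ[ℝ] V) ∘ₗ θ ∘ₗ (a : V →ₗ[ℝ] V)) := by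
  have hab' : ∀ x, a (b x) = x := fun x => by
    rw [← mul_apply_eq_comp, hab, one_apply_eq_self]
  have hba' : ∀ x, b (a x) = x := fun x => by
    rw [← mul_apply_eq_comp, hba, one_apply_eq_self]
  have h0 : ∀ {a : V →L[ℝ] V}, a ∈ homEnd e deg 0 → ∀ {k x}, x ∈ piece e deg k →
      a x ∈ piece e deg k := fun ha k x hx => by simpa using ha k x hx
  refine ⟨fun x => ?_, fun x y => ?_, fun k x hx => h0 hb (h.map_piece k _ (h0 ha hx)),
    fun x hx => ?_⟩
  · simp [hab', h.involutive, hba']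
  · have h1 := h.map_bracket (a x) (a y)
    simp only [twist_apply, hba'] at h1
    simp [h1, hba']
  · have h1 := h.pos (a x) fun h0 => hx (by rw [← hba' x, h0, map_zero])
    rw [kil_twist hba, hba'] at h1
    exact h1

variable [DecidableEq ι]

/-- The candidate Cartan involution, representing `x ↦ -(c x)†` by inner derivations. -/
noncomputable def theta [CompleteSpace V] (e : OrthonormalBasis ι ℝ V)
    (hk : (kil c).Nondegenerate) : V →ₗ[ℝ] V where
  toFun x := ∑ i, c (e i) (adjoint (c x) (dual e hk i))
  map_add' x y := by simp [Finset.sum_add_distrib]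
  map_smul' r x := by simp [Finset.smul_sum]

theorem theta_apply [CompleteSpace V] (hk : (kil c).Nondegenerate) (x : V) :
    theta e hk x = ∑ i, c (e i) (adjoint (c x) (dual e hk i)) := rfl

variable [CompleteSpace V] (hb : IsBracket c) (hc : c ∈ skewOp e deg) (hk : (kil c).Nondegenerate)
  (hcr : IsCritical e deg c)

include hb hc hcr in
theorem apply_theta (x : V) : c (theta e hk x) = -adjoint (c x) := by
  have h1 : ∀ k, ∀ x ∈ piece e deg k, c (theta e hk x) = -adjoint (c x) := fun k x hx => by
    have h2 := hcr.infAct_adjoint_eq_zero (apply_mem_homEnd hc hx) (hb.infAct_eq_zero x)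
    have hD : ∀ y z, adjoint (c x) (c y z) = c (adjoint (c x) y) z + c y (adjoint (c x) z) :=
      fun y z => by
        have h3 : infAct (adjoint (c x)) c y z = 0 := by rw [h2]; rfl
        rw [infAct_apply, sub_sub, sub_eq_zero] at h3
        exact h3
    ext y
    rw [neg_apply, hb.derivation_eq e hk _ hD y, neg_neg, theta_apply]
  conv_lhs => rw [← e.sum_repr' x]
  conv_rhs => rw [← e.sum_repr' x]
  simp only [map_sum, map_smul, h1 _ _ (basis_mem_piece e deg _), ← Finset.sum_neg_distrib]
  refine Finset.sum_congr rfl fun i _ => ?_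
  exact smul_neg _ _

include hb hc hcr in
theorem isReversing_theta : IsReversing e deg c (theta e hk) := by
  have hθ := apply_theta hb hc hk hcr
  have hcomm : ∀ x y, c (c x y) = c x * c y - c y * c x := fun x y => by
    ext z
    simp [hb.jacobi x y z]
  refine ⟨fun x => ?_, fun x y => ?_, fun k x hx => ?_, fun x hx => ?_⟩
  · refine eq_of_apply_eq e hk ?_
    rw [hθ, hθ, map_neg, neg_neg, ContinuousLinearMap.adjoint_adjoint]
  · refine eq_of_apply_eq e hk ?_
    rw [hθ, hcomm, hcomm, hθ, hθ, map_sub, neg_mul_neg, neg_mul_neg]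
    change -(adjoint (c x ∘L c y) - adjoint (c y ∘L c x)) = _
    rw [ContinuousLinearMap.adjoint_comp, ContinuousLinearMap.adjoint_comp, neg_sub]
    rfl
  · rw [theta_apply]
    refine Submodule.sum_mem _ fun i _ => ?_
    have h1 := hc.2 _ _ _ (basis_mem_piece e deg i) _
      (adjoint_mem_homEnd e deg (apply_mem_homEnd hc hx) _ _ (dual_mem_piece hc hk i))
    rwa [add_neg_cancel_left] at h1
  · have h1 : -kil c x (theta e hk x) = ∑ i, ‖adjoint (c x) (e i)‖ ^ 2 := by
      rw [kil_apply, hθ, LinearMap.trace_eq_sum_inner _ e, ← Finset.sum_neg_distrib]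
      refine Finset.sum_congr rfl fun i _ => ?_
      rw [← real_inner_self_eq_norm_sq, ContinuousLinearMap.adjoint_inner_left]
      simp
    rw [h1]
    refine lt_of_le_of_ne (by positivity) fun h => hx ?_
    have h2 : ∀ i, adjoint (c x) (e i) = 0 := fun i => by
      have h3 := (Finset.sum_eq_zero_iff_of_nonneg fun i _ => by positivity).mp h.symm i
        (Finset.mem_univ i)
      simpa using h3
    have h3 : adjoint (c x) = 0 := by
      ext y
      rw [← e.sum_repr' y]
      simp [h2]
    refine eq_of_apply_eq e hk ?_
    rw [map_zero, ← ContinuousLinearMap.adjoint_adjoint (c x), h3, map_zero]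

omit [CompleteSpace V] in
/-- Every nondegenerate graded bracket has a Cartan involution reversing the gradation. -/
theorem IsBracket.exists_isReversing (hb : IsBracket c) (hc : c ∈ skewOp e deg)
    (hk : (kil c).Nondegenerate) : ∃ θ, IsReversing e deg c θ := by
  have : FiniteDimensional ℝ V := e.toBasis.finiteDimensional_of_finite
  have : CompleteSpace V := FiniteDimensional.complete ℝ V
  obtain ⟨c', hc', hb', hcs', hk', hcr'⟩ := hb.exists_critical hc hk
  obtain ⟨c'', ⟨a, b, ha, hb₁, hab, hba, -, rfl⟩, h⟩ :=
    ((mem_closure_iff_frequently.mp hc').and_eventually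
      (hb'.eventually_exists_twist e hcs' hk')).exists
  obtain ⟨a', b', ha', hb₁', hab', hba', h'⟩ :=
    h (twist_mem_skewOp ha hb₁ hc) (hb.transport hba)
  obtain ⟨θ, h1⟩ : ∃ θ, IsReversing e deg c' θ := ⟨_, isReversing_theta hb' hcs' hk' hcr'⟩
  have h2 : c' = twist b' a' (twist a b c) := by
    rw [h', twist_twist, hba', twist_one]
  rw [h2] at h1
  exact ⟨_, (h1.transport hb₁' ha' hba' hab').transport ha hb₁ hab hba⟩

end Critical

section Transport

variable {V : Type*} [NormedAddCommGroup V] [InnerProductSpace ℝ V] [FiniteDimensional ℝ V]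
  {L : Type*} [LieRing L] [LieAlgebra ℝ L] (φ : L ≃ₗ[ℝ] V)

/-- The Lie bracket of `L` transported along a linear isomorphism. -/
noncomputable def bracketOp : V →L[ℝ] V →L[ℝ] V :=
  LinearMap.toContinuousLinearMap
    { toFun := fun x => LinearMap.toContinuousLinearMap (φ.conj (LieAlgebra.ad ℝ L (φ.symm x)))
      map_add' := fun x y => by simp
      map_smul' := fun r x => by simp }

@[simp]
theorem bracketOp_apply (x y : V) : bracketOp φ x y = φ ⁅φ.symm x, φ.symm y⁆ := rfl

theorem isBracket_bracketOp : IsBracket (bracketOp φ) where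
  skew x y := by simp only [bracketOp_apply, ← map_neg, lie_skew]
  jacobi x y z := by
    simp only [bracketOp_apply, LinearEquiv.symm_apply_apply, ← map_add, ← leibniz_lie]

theorem kil_bracketOp (x y : L) : kil (bracketOp φ) (φ x) (φ y) = killingForm ℝ L x y := by
  rw [kil_apply, LieModule.traceForm_apply_apply, ← LinearMap.trace_conj' _ φ]
  congr 1
  ext z
  simp

theorem nondegenerate_kil_bracketOp (h : (killingForm ℝ L).Nondegenerate) :
    (kil (bracketOp φ)).Nondegenerate := by
  have h1 : kil (bracketOp φ) = LinearMap.BilinForm.congr φ (killingForm ℝ L) := by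
    ext x y
    rw [LinearMap.BilinForm.congr_apply, ← kil_bracketOp φ, φ.apply_symm_apply, φ.apply_symm_apply]
  rw [h1]
  exact LinearMap.BilinForm.Nondegenerate.congr φ h

end Transport

theorem exists_orthonormalBasis_mem_piece_iff {Γ L : Type*} [Fintype Γ] [DecidableEq Γ]
    [AddCommGroup L] [Module ℝ L] [Module.Finite ℝ L] (g : Γ → Submodule ℝ L)
    (hg : DirectSum.IsInternal g) :
    ∃ (n : Γ → ℕ) (φ : L ≃ₗ[ℝ] EuclideanSpace ℝ (Σ k, Fin (n k))), ∀ k x,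
      x ∈ g k ↔ φ x ∈ piece (EuclideanSpace.basisFun (Σ k, Fin (n k)) ℝ) Sigma.fst k := by
  set b := hg.collectedBasis fun k => Module.finBasis ℝ (g k) with hb
  refine ⟨_, b.equivFun ≪≫ₗ (WithLp.linearEquiv 2 ℝ _).symm, fun k x => ?_⟩
  rw [mem_piece]
  have hφ : ∀ i, ⟪EuclideanSpace.basisFun _ ℝ i,
      (b.equivFun ≪≫ₗ (WithLp.linearEquiv 2 ℝ _).symm) x⟫_ℝ = b.repr x i := fun i => by
    simp [EuclideanSpace.inner_single_left]
  simp only [hφ]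
  constructor
  · rintro hx ⟨j, a⟩ hj
    exact hg.collectedBasis_repr_of_mem_ne _ (Ne.symm hj) hx
  · intro h
    rw [← b.sum_repr x]
    refine sum_mem fun i _ => ?_
    by_cases hi : i.1 = k
    · exact Submodule.smul_mem _ _ (hi ▸ hg.collectedBasis_mem _ i)
    · rw [h i hi, zero_smul]
      exact zero_mem _

end GradedCartan

open GradedCartan in
/-- Every finite-dimensional real `ℤ/m`-graded semisimple Lie algebra admits a Cartan
involution reversing the gradation: an involutive Lie algebra automorphism `τ` with
`τ(g_k) = g_{-k}` for all `k`, such that `B_τ(x, y) = -κ(x, τ y)` is positive definite. -/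
theorem exists_grade_reversing_cartan_involution {m : ℕ} [NeZero m] {L : Type*} [LieRing L]
    [LieAlgebra ℝ L] [Module.Finite ℝ L] [LieAlgebra.IsSemisimple ℝ L]
    (g : ZMod m → Submodule ℝ L) (hg : DirectSum.IsInternal g)
    (hgb : ∀ i j : ZMod m, ∀ x ∈ g i, ∀ y ∈ g j, ⁅x, y⁆ ∈ g (i + j)) :
    ∃ τ : L ≃ₗ⁅ℝ⁆ L, (∀ x : L, τ (τ x) = x) ∧
      (∀ k : ZMod m, (fun x => τ x) '' (g k : Set L) = (g (-k) : Set L)) ∧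
      (∀ x : L, x ≠ 0 → 0 < -(killingForm ℝ L x (τ x))) := by
  obtain ⟨n, φ, hφ⟩ := exists_orthonormalBasis_mem_piece_iff g hg
  have hφ' : ∀ k x, x ∈ piece (EuclideanSpace.basisFun (Σ k, Fin (n k)) ℝ) Sigma.fst k →
      φ.symm x ∈ g k := fun k x hx => (hφ k _).mpr (by rwa [φ.apply_symm_apply])
  obtain ⟨θ, hθ⟩ := (isBracket_bracketOp φ).exists_isReversing
    (e := EuclideanSpace.basisFun (Σ k, Fin (n k)) ℝ) (deg := Sigma.fst)
    ⟨(isBracket_bracketOp φ).skew, fun k l x hx y hy =>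
      (hφ _ _).mp (hgb k l _ (hφ' k x hx) _ (hφ' l y hy))⟩
    (nondegenerate_kil_bracketOp φ (LieAlgebra.IsKilling.killingForm_nondegenerate ℝ L))
  have hinv : ∀ x, φ.symm (θ (φ (φ.symm (θ (φ x))))) = x := fun x => by
    rw [φ.apply_symm_apply, hθ.involutive, φ.symm_apply_apply]
  let τ : L ≃ₗ⁅ℝ⁆ L :=
    { toFun := fun x => φ.symm (θ (φ x))
      invFun := fun x => φ.symm (θ (φ x))
      map_add' := fun x y => by simp
      map_smul' := fun r x => by simp
      map_lie' := fun {x y} => by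
        have h := hθ.map_bracket (φ x) (φ y)
        simp only [bracketOp_apply, φ.symm_apply_apply] at h
        exact (congrArg φ.symm h).trans (φ.symm_apply_apply _)
      left_inv := hinv
      right_inv := hinv }
  have hτ : ∀ k, ∀ x ∈ g k, τ x ∈ g (-k) := fun k x hx =>
    hφ' _ _ (hθ.map_piece k _ ((hφ k x).mp hx))
  refine ⟨τ, hinv, fun k => Set.Subset.antisymm ?_ fun x hx => ⟨τ x, ?_, hinv x⟩, fun x hx => ?_⟩
  · rintro _ ⟨x, hx, rfl⟩
    exact hτ k x hx
  · simpa using hτ (-k) x hx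
  · have h := hθ.pos (φ x) (by simpa using hx)
    rwa [← φ.apply_symm_apply (θ (φ x)), kil_bracketOp] at h
end

section
/- Let g = ⊕_{i ∈ ℤ/mℤ} g_i be a finite-dimensional real ℤ_m-graded semisimple Lie algebra and let (h, e, f) be an sl₂-triple with h ∈ g_0, e ∈ g_1, f ∈ g_{−1}. For k ∈ ℤ set g_k(h/2) = {x ∈ g_{k mod m} : ⁅h, x⁆ = 2k·x}. If e′ ∈ g_1(h/2) is generic, i.e. ⁅g_0(h/2), e′⁆ = g_1(h/2), then there exists f′ ∈ g_{−1}(h/2) such that (h, e′, f′) is an sl₂-triple. -/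
namespace Module.End

variable {K M : Type*} [Field K] [AddCommGroup M] [Module K M]

/-- An operator which shifts the weights of another operator by a nonzero scalar is nilpotent. -/
lemma isNilpotent_of_shift [CharZero K] [FiniteDimensional K M] {H E : Module.End K M} {c : K} (hc : c ≠ 0)
    (hE : H * E = E * H + c • E) : IsNilpotent E := by
  by_contra hn
  have hne (n : ℕ) : E ^ n ≠ 0 := fun h => hn ⟨n, h⟩
  have hpow (n : ℕ) : H * E ^ n = E ^ n * H + (n * c) • E ^ n := by
    induction n with
    | zero => simp
    | succ n ih =>
      rw [pow_succ, ← mul_assoc, ih, add_mul, mul_assoc, hE, mul_add, smul_mul_assoc,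
        mul_smul_comm, ← mul_assoc, Nat.cast_succ]
      module
  have hli := Module.End.eigenvectors_linearIndependent'
    (LinearMap.mulLeft K H - LinearMap.mulRight K H) (fun n : ℕ => (n : K) * c)
    (fun i j hij => by simpa [hc] using hij) (fun n => E ^ n)
    (fun n => Module.End.hasEigenvector_iff.mpr
      ⟨Module.End.mem_eigenspace_iff.mpr (by simp [hpow]), hne n⟩)
  exact not_finite_iff_infinite.mpr inferInstance hli.finite

section Sl2

variable {H E F : Module.End K M} (hE : ∀ v, H (E v) = E (H v) + (2 : K) • E v)
  (hF : ∀ v, H (F v) = F (H v) - (2 : K) • F v) (hEF : ∀ v, E (F v) = F (E v) + H v)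

include hF in
lemma sl2_apply_pow (k : ℕ) (v : M) :
    H ((F ^ k) v) = (F ^ k) (H v) - (2 * k : K) • (F ^ k) v := by
  induction k with
  | zero => simp
  | succ k ih =>
    rw [pow_succ', mul_apply, mul_apply, hF, ih, map_sub, map_smul]
    push_cast
    module

include hF hEF in
lemma sl2_apply_pow_succ (k : ℕ) {v : M} (hv : E v = 0) :
    E ((F ^ (k + 1)) v) = (k + 1 : K) • (F ^ k) (H v - (k : K) • v) := by
  induction k with
  | zero => simp [hEF, hv]
  | succ k ih =>
    rw [pow_succ', mul_apply, hEF, ih, sl2_apply_pow hF, map_smul, ← mul_apply, ← pow_succ',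
      map_sub, map_sub, map_smul, map_smul]
    push_cast
    module

include hF hEF in
/-- The weight of a primitive vector is a natural number. -/
lemma sl2_primitive_weight [CharZero K] (k : ℕ) {v : M} {μ : K} (hv : E v = 0) (hμ : H v = μ • v)
    (hk : (F ^ k) v = 0) (hv0 : v ≠ 0) : ∃ i < k, μ = i := by
  induction k with
  | zero => exact absurd hk hv0
  | succ k ih =>
    have h1 := sl2_apply_pow_succ hF hEF k hv
    rw [hk, map_zero, hμ, ← sub_smul, map_smul, smul_smul, eq_comm, smul_eq_zero, mul_eq_zero,
      sub_eq_zero] at h1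
    rcases h1 with (h1 | h1) | h1
    · exact absurd h1 (Nat.cast_add_one_ne_zero k)
    · exact ⟨k, k.lt_succ_self, h1⟩
    · obtain ⟨i, hi, h⟩ := ih h1
      exact ⟨i, hi.trans k.lt_succ_self, h⟩

include hE hF hEF in
/-- `H` acts semisimply on the kernel of `E`. -/
lemma sl2_semisimple_of_primitive [CharZero K] (k : ℕ) {v : M} {μ : K} (hv : E v = 0)
    (hμ : H (H v - μ • v) = μ • (H v - μ • v)) (hk : (F ^ k) v = 0) : H v = μ • v := by
  induction k generalizing v with
  | zero =>
    obtain rfl : v = 0 := hk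
    simp
  | succ k ih =>
    have hEH (c : K) : E (H v - c • v) = 0 := by
      have := hE v
      rw [hv, map_zero, smul_zero, add_zero] at this
      rw [map_sub, ← this, map_smul, hv, smul_zero, sub_zero]
    have h1 := sl2_apply_pow_succ hF hEF k hv
    rw [hk, map_zero, eq_comm, smul_eq_zero] at h1
    replace h1 := h1.resolve_left (Nat.cast_add_one_ne_zero k)
    by_cases hμk : μ = k
    · by_contra hne
      obtain ⟨i, hi, h⟩ := sl2_primitive_weight hF hEF k (hEH μ) hμ (hμk ▸ h1)
        (sub_ne_zero.mpr hne)
      rw [hμk, Nat.cast_inj] at h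
      omega
    · have h2 := ih (hEH k) (by
        simp only [map_sub, map_smul] at hμ ⊢
        have := congrArg H hμ
        simp only [map_sub, map_smul] at this
        linear_combination (norm := module) this - (k : K) • hμ) h1
      simp only [map_sub, map_smul] at h2 hμ
      have h3 : (μ - k) • (H v - μ • v) = 0 := by
        linear_combination (norm := module) h2 - hμ
      exact sub_eq_zero.mp ((smul_eq_zero.mp h3).resolve_left (sub_ne_zero.mpr hμk))

/-- The Casimir operator of a triple of operators. -/
def casimir (H E F : Module.End K M) : Module.End K M :=
  H * H + (2 : K) • H + (4 : K) • (F * E)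

lemma casimir_apply (v : M) :
    casimir H E F v = H (H v) + (2 : K) • H v + (4 : K) • F (E v) := rfl

include hE hF in
lemma commute_casimir_left : Commute (casimir H E F) H := by
  ext v
  simp only [mul_apply, casimir_apply, map_add, map_smul, hF, hE]
  module

include hE hEF in
lemma commute_casimir_right : Commute (casimir H E F) E := by
  ext v
  simp only [mul_apply, casimir_apply, map_add, map_smul, hEF, hE]
  module

lemma casimir_primitive {v : M} {μ : K} (hv : E v = 0) (hμ : H v = μ • v) :
    casimir H E F v = (μ * (μ + 2)) • v := by
  rw [casimir_apply, hv, hμ, map_smul, hμ, map_zero]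
  module

open Polynomial

lemma aeval_apply_comm {Ω G : Module.End K M} (h : Commute Ω G) (r : K[X]) (v : M) :
    G (aeval Ω r v) = aeval Ω r (G v) := by
  have h1 : Commute G (aeval Ω r) := by
    induction r using Polynomial.induction_on' with
    | add p q hp hq => rw [map_add]; exact hp.add_right hq
    | monomial n a =>
      rw [aeval_monomial]
      exact (Algebra.commute_algebraMap_right a G).mul_right (h.symm.pow_right n)
  exact LinearMap.congr_fun h1 v

include hE hF hEF in
lemma exists_aeval_casimir_eq_zero (b : ℕ) {u : M} {μ κ : K} (hu : H u = μ • u)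
    (hb : (E ^ b) u = 0) (hκ : ∀ j : ℕ, (μ + 2 * j) * (μ + 2 * j + 2) ≠ κ) :
    ∃ r : K[X], r.eval κ ≠ 0 ∧ aeval (casimir H E F) r u = 0 := by
  induction b generalizing u μ with
  | zero =>
    obtain rfl : u = 0 := hb
    exact ⟨1, by simp, by simp⟩
  | succ b ih =>
    obtain ⟨r, hr, hru⟩ := ih (u := E u) (μ := μ + 2) (by rw [hE, hu, map_smul]; module)
      (by rwa [← mul_apply, ← pow_succ]) (fun j => by
        have := hκ (j + 1)
        push_cast at this
        convert this using 1
        ring)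
    refine ⟨(X - C (μ * (μ + 2))) * r, ?_, ?_⟩
    · have := hκ 0
      rw [Nat.cast_zero, mul_zero, add_zero] at this
      rw [eval_mul, eval_sub, eval_X, eval_C]
      exact mul_ne_zero (sub_ne_zero.mpr this.symm) hr
    · have h1 := aeval_apply_comm (commute_casimir_right hE hEF) r u
      have h2 := aeval_apply_comm (commute_casimir_left (E := E) hE hF) r u
      rw [hru] at h1
      rw [hu, map_smul] at h2
      rw [map_mul, mul_apply, map_sub, aeval_X, aeval_C, LinearMap.sub_apply,
        casimir_primitive h1 h2, algebraMap_end_apply, sub_self]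

include hE hF hEF in
/-- In a finite-dimensional representation of `sl₂`, generalized weight vectors are weight
vectors. -/
lemma sl2_semisimple [CharZero K] (hFn : IsNilpotent F) (a : ℕ) {v : M} {μ : K} (ha : (E ^ a) v = 0)
    (hμ : H (H v - μ • v) = μ • (H v - μ • v)) : H v = μ • v := by
  obtain ⟨k, hk⟩ := hFn
  have hFk (x : M) : (F ^ k) x = 0 := by rw [hk]; rfl
  induction a generalizing v μ with
  | zero =>
    obtain rfl : v = 0 := ha
    simp
  | succ a ih =>
    have h1 : H (E v) = (μ + 2) • E v := by
      refine ih (by rwa [← mul_apply, ← pow_succ]) ?_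
      have := congrArg E hμ
      simp only [map_sub, map_smul, hE, map_add] at this ⊢
      linear_combination (norm := module) this
    have h2 : E (H v - μ • v) = 0 := by
      have := hE v
      rw [h1] at this
      rw [map_sub, map_smul]
      linear_combination (norm := module) -this
    by_contra hne
    rw [← sub_eq_zero] at hne
    obtain ⟨n, -, rfl⟩ := sl2_primitive_weight hF hEF k h2 hμ (hFk _) hne
    obtain ⟨r, hr, hrv⟩ := exists_aeval_casimir_eq_zero hE hF hEF a (κ := (n : K) * (n + 2)) h1
      (by rwa [← mul_apply, ← pow_succ]) (fun j => by
        norm_cast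
        intro h
        nlinarith)
    have hcE := aeval_apply_comm (commute_casimir_right (F := F) hE hEF) r
    have hcH := aeval_apply_comm (commute_casimir_left (E := E) hE hF) r
    have h3 : H (aeval (casimir H E F) r v) = (n : K) • aeval (casimir H E F) r v := by
      refine sl2_semisimple_of_primitive hE hF hEF k (by rw [hcE, hrv]) ?_ (hFk _)
      rw [hcH, ← map_smul, ← map_sub, hcH, hμ, map_smul]
    rw [hcH, ← map_smul, ← sub_eq_zero, ← map_sub, aeval_apply_of_hasEigenvector
      (hasEigenvector_iff.mpr ⟨mem_eigenspace_iff.mpr (casimir_primitive h2 hμ), hne⟩),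
      smul_eq_zero] at h3
    exact h3.elim hr hne

end Sl2

end Module.End

open Polynomial in
/-- If `A` is surjective, then `(A + t B) y(t) = q(t) w` has a polynomial solution with
`q(0) = 1`. The polynomials `y` and `q` are given by their coefficients. -/
lemma LinearMap.exists_polynomial_pencil_solution {K U W : Type*} [Field K] [AddCommGroup U]
    [Module K U] [AddCommGroup W] [Module K W] [FiniteDimensional K W] (A B : U →ₗ[K] W)
    (hA : Function.Surjective A) (w : W) :
    ∃ (d : ℕ) (y : ℕ → U) (q : ℕ → K), q 0 = 1 ∧ (∀ n, d ≤ n → y n = 0) ∧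
      (∀ n, d < n → q n = 0) ∧ A (y 0) = w ∧
      ∀ n, A (y (n + 1)) + B (y n) = q (n + 1) • w := by
  obtain ⟨s, hs⟩ := A.exists_rightInverse_of_surjective (LinearMap.range_eq_top.mpr hA)
  have hAs (v : W) : A (s v) = v := LinearMap.congr_fun hs v
  let P : Module.End K W := -(B ∘ₗ s)
  let p : K[X] := P.charpoly
  let d := p.natDegree
  have hp1 : p.coeff d = 1 := P.charpoly_monic
  let q : ℕ → K := fun n => if n ≤ d then p.coeff (d - n) else 0
  let r : ℕ → W := fun n => Nat.rec w (fun k v => P v + q (k + 1) • w) n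
  have hr (n : ℕ) : r (n + 1) = P (r n) + q (n + 1) • w := rfl
  have hq0 : q 0 = 1 := by simp [q, hp1]
  have hrsum (n : ℕ) : r n = ∑ i ∈ Finset.range (n + 1), q i • (P ^ (n - i)) w := by
    induction n with
    | zero => simp [hq0, r]
    | succ n ih =>
      rw [hr, ih, Finset.sum_range_succ _ (n + 1), map_sum]
      congr 1
      · refine Finset.sum_congr rfl fun i hi => ?_
        have : n + 1 - i = (n - i) + 1 := by have := Finset.mem_range.mp hi; omega
        rw [this, pow_succ', map_smul, Module.End.mul_apply]
      · simp
  have hrd : r d = 0 := by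
    have h1 : (aeval P p) w = 0 := by rw [P.aeval_self_charpoly]; rfl
    rw [aeval_eq_sum_range, LinearMap.sum_apply] at h1
    rw [hrsum, ← h1, ← Finset.sum_range_reflect]
    refine Finset.sum_congr rfl fun i hi => ?_
    have hi' := Finset.mem_range.mp hi
    have e2 : d - (d - i) = i := by omega
    simp [q, e2, d]
  have hrz (n : ℕ) (hn : d ≤ n) : r n = 0 := by
    induction n, hn using Nat.le_induction with
    | base => exact hrd
    | succ n hn ih =>
      have : ¬ n + 1 ≤ d := by omega
      simp [hr, ih, q, this]
  refine ⟨d, fun n => s (r n), q, hq0, fun n hn => by simp [hrz n hn],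
    fun n hn => if_neg (by omega), hAs w, fun n => ?_⟩
  rw [hAs, hr]
  simp only [P, LinearMap.neg_apply, LinearMap.comp_apply]
  abel

open Polynomial Finset in
/-- Let `T` be a space closed under commutators and let `e`, `e'` satisfy
`⁅T, e⁆ = ⁅T, e'⁆ = V` with `e' ∈ V`. A linear form which vanishes on commutators of elements of
`T` and on the centralizer of `e` in `T` also vanishes on the centralizer of `e'` in `T`. -/
lemma eq_zero_of_commute_of_generic {K E : Type*} [Field K] [CharZero K] [Ring E] [Algebra K E]
    (T V : Submodule K E) [FiniteDimensional K V] (e e' : E)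
    (hT : ∀ a ∈ T, ∀ b ∈ T, a * b - b * a ∈ T) (χ : E →ₗ[K] K)
    (hχ : ∀ a ∈ T, ∀ b ∈ T, χ (a * b - b * a) = 0)
    (heV : ∀ a ∈ T, a * e - e * a ∈ V) (heV' : ∀ v ∈ V, ∃ a ∈ T, a * e - e * a = v)
    (hfV : ∀ a ∈ T, a * e' - e' * a ∈ V) (hfV' : ∀ v ∈ V, ∃ a ∈ T, a * e' - e' * a = v)
    (he' : e' ∈ V) (hχe : ∀ a ∈ T, a * e = e * a → χ a = 0)
    (a : E) (ha : a ∈ T) (hae : a * e' = e' * a) : χ a = 0 := by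
  let A : T →ₗ[K] V := (LinearMap.mulRight K e - LinearMap.mulLeft K e).restrict heV
  let B : T →ₗ[K] V := (LinearMap.mulRight K e' - LinearMap.mulLeft K e').restrict hfV
  have hA (x : T) : (A x : E) = x * e - e * x := rfl
  have hB (x : T) : (B x : E) = x * e' - e' * x := rfl
  have hAs : Function.Surjective A := fun v => by
    obtain ⟨b, hb, hbv⟩ := heV' v v.2
    exact ⟨⟨b, hb⟩, Subtype.ext hbv⟩
  have hBs : Function.Surjective B := fun v => by
    obtain ⟨b, hb, hbv⟩ := hfV' v v.2
    exact ⟨⟨b, hb⟩, Subtype.ext hbv⟩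
  let x : E[X] := C e + X * C e'
  have hmx (p : E[X]) (n : ℕ) :
      (p * x).coeff (n + 1) = p.coeff (n + 1) * e + p.coeff n * e' := by
    rw [mul_add, ← mul_assoc, coeff_add, coeff_mul_C, coeff_mul_C, coeff_mul_X]
  have hxm (p : E[X]) (n : ℕ) :
      (x * p).coeff (n + 1) = e * p.coeff (n + 1) + e' * p.coeff n := by
    rw [add_mul, mul_assoc, coeff_add, coeff_C_mul, coeff_X_mul, coeff_C_mul]
  -- a polynomial `y` with coefficients in `T` and `⁅y, x⁆ = Q * x'`, `Q 0 = 1`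
  obtain ⟨y, Q, hyT, hQ0, hQc, hQχ, hyx⟩ : ∃ y Q : E[X], (∀ n, y.coeff n ∈ T) ∧
      Q.coeff 0 = 1 ∧ (∀ z : E[X], Q * z = z * Q) ∧
      (∀ n, ∃ c : K, Q.coeff n = algebraMap K E c) ∧ y * x - x * y = Q * C e' := by
    obtain ⟨d, y, q, hq0, hyd, hqd, hy0, hyn⟩ :=
      A.exists_polynomial_pencil_solution B hAs ⟨e', he'⟩
    let y' : E[X] := ∑ i ∈ range d, monomial i (y i : E)
    let Q : E[X] := ∑ i ∈ range (d + 1), monomial i (algebraMap K E (q i))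
    have hy' (n : ℕ) : y'.coeff n = y n := by
      simp only [y', finsetSum_coeff, coeff_monomial, sum_ite_eq', mem_range]
      split_ifs with h
      · rfl
      · simp [hyd n (by omega)]
    have hQ' (n : ℕ) : Q.coeff n = algebraMap K E (q n) := by
      simp only [Q, finsetSum_coeff, coeff_monomial, sum_ite_eq', mem_range]
      split_ifs with h
      · rfl
      · simp [hqd n (by omega)]
    refine ⟨y', Q, fun n => by rw [hy']; exact (y n).2, by simp [hQ', hq0], fun z => ?_,
      fun n => ⟨_, hQ' n⟩, ?_⟩
    · ext n
      rw [coeff_mul, coeff_mul, ← Finset.Nat.sum_antidiagonal_swap]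
      refine sum_congr rfl fun i _ => ?_
      simp only [Prod.fst_swap, Prod.snd_swap, hQ']
      exact Algebra.commutes _ _
    · ext n
      cases n with
      | zero =>
        have := congrArg (Subtype.val) hy0
        rw [hA] at this
        simp [x, hy', hQ', hq0, mul_coeff_zero, this]
      | succ n =>
        have := congrArg (Subtype.val) (hyn n)
        rw [Submodule.coe_add, hA, hB, Submodule.coe_smul, Algebra.smul_def] at this
        rw [coeff_sub, hmx, hxm, coeff_mul_C, hy', hy', hQ', ← this]
        abel
  have hDx : derivative x = C e' := by simp [x]
  -- the derivation `z ↦ Q z' - ⁅y, z⁆` preserves the centralizer of `x`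
  have key (n : ℕ) : ∀ z : E[X], (∀ n, z.coeff n ∈ T) → z * x = x * z → χ (z.coeff n) = 0 := by
    induction n using Nat.strong_induction_on with
    | _ n ih =>
    intro z hz hzx
    cases n with
    | zero =>
      refine hχe _ (hz 0) ?_
      have := congrArg (fun p => coeff p 0) hzx
      simpa [x, mul_coeff_zero] using this
    | succ n =>
      let z' := Q * derivative z - (y * z - z * y)
      have hcoeff (n : ℕ) : z'.coeff n = ∑ i ∈ antidiagonal n,
          (Q.coeff i.1 * (z.coeff (i.2 + 1) * ((i.2 : E) + 1)) -
            (y.coeff i.1 * z.coeff i.2 - z.coeff i.2 * y.coeff i.1)) := by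
        simp only [z', coeff_sub, coeff_mul, coeff_derivative, sum_sub_distrib]
        congr 2
        rw [← Finset.Nat.sum_antidiagonal_swap]
        rfl
      have hterm (c : K) (k : ℕ) (b : E) :
          algebraMap K E c * (b * ((k : E) + 1)) = (c * (k + 1)) • b := by
        have : ((k : E) + 1) = algebraMap K E (k + 1) := by simp
        rw [this, ← Algebra.commutes, ← mul_assoc, ← map_mul, Algebra.smul_def]
      have hz'T (n : ℕ) : z'.coeff n ∈ T := by
        rw [hcoeff]
        refine Submodule.sum_mem _ fun i _ => Submodule.sub_mem _ ?_ (hT _ (hyT _) _ (hz _))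
        obtain ⟨c, hc⟩ := hQχ i.1
        rw [hc, hterm]
        exact T.smul_mem _ (hz _)
      have hz'x : z' * x = x * z' := by
        have h1 : derivative z * x + z * C e' = C e' * z + x * derivative z := by
          have := congrArg derivative hzx
          rwa [derivative_mul, derivative_mul, hDx] at this
        have h2 : y * x = x * y + Q * C e' := by rw [← hyx]; abel
        have h3 : Q * x = x * Q := hQc x
        have h4 : Q * z = z * Q := hQc z
        rw [← sub_eq_zero]
        have e1 : z' * x - x * z' = Q * (derivative z * x - x * derivative z)
            + (Q * x - x * Q) * derivative z - y * (z * x) + z * (y * x) + (x * y) * z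
              - (x * z) * y := by
          simp only [z']; noncomm_ring
        have e2 : derivative z * x - x * derivative z = C e' * z - z * C e' := by
          rw [sub_eq_sub_iff_add_eq_add, h1]
        have e3 : y * (z * x) = (x * y + Q * C e') * z := by
          rw [hzx, ← mul_assoc, h2]
        have e4 : Q * (z * C e') = z * (Q * C e') := by
          rw [← mul_assoc, h4, mul_assoc]
        rw [e1, e2, e3, h3, h2, ← hzx, mul_sub, e4]
        noncomm_ring
      have h0 := ih n (Nat.lt_succ_self n) z' hz'T hz'x
      rw [hcoeff, map_sum, ← Finset.add_sum_erase _ _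
        (show ((0, n) : ℕ × ℕ) ∈ antidiagonal n by simp), Finset.sum_eq_zero, add_zero,
        map_sub, hχ _ (hyT _) _ (hz _), sub_zero] at h0
      · simp only [hQ0] at h0
        have e1 := hterm 1 n (z.coeff (n + 1))
        rw [map_one] at e1
        rw [e1, map_smul, smul_eq_mul, one_mul, mul_eq_zero] at h0
        exact h0.resolve_left (by exact_mod_cast Nat.succ_ne_zero n)
      · rintro ⟨i, j⟩ hij
        obtain ⟨hne, hij⟩ := Finset.mem_erase.mp hij
        rw [HasAntidiagonal.mem_antidiagonal] at hij
        have hj : j + 1 < n + 1 := by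
          rcases Nat.eq_zero_or_pos i with rfl | hi
          · exact absurd (by simpa using hij) (fun h => hne (by rw [h]))
          · simp only at hij; omega
        obtain ⟨c, hc⟩ := hQχ i
        simp only
        rw [map_sub, hχ _ (hyT _) _ (hz _), hc, hterm, map_smul, ih _ hj z hz hzx]
        simp
  -- a polynomial centralizing `x` with leading coefficient `a`
  obtain ⟨d, y, q, -, hyd, hqd, hy0, hyn⟩ :=
    B.exists_polynomial_pencil_solution A hBs (A ⟨a, ha⟩)
  have hBa : B ⟨a, ha⟩ = 0 := Subtype.ext (by rw [hB, hae]; simp)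
  let c : ℕ → T := fun n => Nat.casesOn n ⟨a, ha⟩ fun n => q (n + 1) • ⟨a, ha⟩ - y n
  have hc0 : c 0 = ⟨a, ha⟩ := rfl
  have hcs (n : ℕ) : c (n + 1) = q (n + 1) • ⟨a, ha⟩ - y n := rfl
  have hcd : c (d + 1) = 0 := by rw [hcs, hyd d le_rfl, hqd _ (Nat.lt_succ_self d)]; simp
  have hc (n : ℕ) : B (c (n + 1)) + A (c n) = 0 := by
    rw [hcs, map_sub, map_smul, hBa, smul_zero, zero_sub]
    cases n with
    | zero => rw [hy0, hc0]; abel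
    | succ n => rw [hcs, map_sub, map_smul, ← hyn n]; abel
  let z : E[X] := ∑ i ∈ range (d + 1), monomial i (Subtype.val (c (d - i)))
  have hzc (n : ℕ) (hn : n ≤ d) : z.coeff n = Subtype.val (c (d - n)) := by
    simp only [z, finsetSum_coeff, coeff_monomial, sum_ite_eq', mem_range]
    exact if_pos (by omega)
  have hzc' (n : ℕ) (hn : d < n) : z.coeff n = 0 := by
    simp only [z, finsetSum_coeff, coeff_monomial, sum_ite_eq', mem_range]
    exact if_neg (by omega)
  have hz : χ (z.coeff d) = 0 := by
    refine key d z (fun n => ?_) ?_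
    · rcases le_or_gt n d with h | h
      · rw [hzc n h]; exact (c _).2
      · rw [hzc' n h]; exact T.zero_mem
    · rw [← sub_eq_zero]
      ext n
      cases n with
      | zero =>
        have h1 := congrArg Subtype.val (hc d)
        rw [hcd, map_zero, zero_add, hA] at h1
        simpa [x, mul_coeff_zero, hzc 0 (Nat.zero_le d)] using h1
      | succ n =>
        have e1 : (z * x - x * z).coeff (n + 1) = (z.coeff n * e' - e' * z.coeff n) +
            (z.coeff (n + 1) * e - e * z.coeff (n + 1)) := by
          rw [coeff_sub, hmx, hxm]
          abel
        rw [e1, coeff_zero]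
        rcases lt_trichotomy n d with h | rfl | h
        · have h1 := congrArg Subtype.val (hc (d - (n + 1)))
          rw [Submodule.coe_add, hA, hB, show d - (n + 1) + 1 = d - n by omega] at h1
          rw [hzc n h.le, hzc (n + 1) h, h1]
          rfl
        · rw [hzc n le_rfl, hzc' _ (Nat.lt_succ_self n), Nat.sub_self, hc0]
          simp [hae]
        · rw [hzc' n h, hzc' (n + 1) (by omega)]
          simp
  rwa [hzc d le_rfl, Nat.sub_self] at hz

/-- If `f` and `f ^ 2` have the same kernel on an invariant subspace, then every element of this
subspace is the sum of an element of the kernel and an element of the range. -/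
lemma LinearMap.exists_add_apply_eq {K M : Type*} [Field K] [AddCommGroup M] [Module K M]
    [FiniteDimensional K M] (f : Module.End K M) {p : Submodule K M} (hp : ∀ x ∈ p, f x ∈ p)
    (hf : ∀ x ∈ p, f (f x) = 0 → f x = 0) {y : M} (hy : y ∈ p) :
    ∃ a ∈ p, ∃ b ∈ p, f a = 0 ∧ y = a + f b := by
  let g : Module.End K p := f.restrict hp
  have hg (x : p) : (g x : M) = f x := rfl
  have hdisj : Disjoint (LinearMap.ker g) (LinearMap.range g) := by
    rw [Submodule.disjoint_def]
    rintro x hx ⟨z, rfl⟩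
    refine Subtype.ext (hf z z.2 ?_)
    simpa [hg] using congrArg Subtype.val (LinearMap.mem_ker.mp hx)
  have htop : LinearMap.ker g ⊔ LinearMap.range g = ⊤ :=
    Submodule.eq_top_of_disjoint _ _ (by rw [add_comm, g.finrank_range_add_finrank_ker]) hdisj
  obtain ⟨a, ha, z, ⟨b, rfl⟩, hab⟩ := Submodule.mem_sup.mp
    (show (⟨y, hy⟩ : p) ∈ LinearMap.ker g ⊔ LinearMap.range g from htop ▸ Submodule.mem_top)
  refine ⟨a, a.2, b, b.2, ?_, ?_⟩
  · simpa [hg] using congrArg Subtype.val (LinearMap.mem_ker.mp ha)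
  · simpa [hg] using congrArg Subtype.val hab.symm

section Graded

variable {ι K L : Type*} [AddCommGroup ι] [Field K] [LieRing L] [LieAlgebra K L]
  [Module.Finite K L] {g : ι → Submodule K L}

/-- Components of a graded Lie algebra are orthogonal for the Killing form unless their degrees
add up to zero. -/
lemma killingForm_eq_zero_of_graded [DecidableEq ι] (hg : DirectSum.IsInternal g)
    (hgb : ∀ i j : ι, ∀ x ∈ g i, ∀ y ∈ g j, ⁅x, y⁆ ∈ g (i + j)) {i j : ι} (hij : i + j ≠ 0)
    {x y : L} (hx : x ∈ g i) (hy : y ∈ g j) : killingForm K L x y = 0 := by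
  rw [killingForm_apply_apply]
  refine LinearMap.trace_eq_zero_of_mapsTo_ne hg (fun k => i + (j + k)) (fun k h => hij ?_)
    fun k z hz => hgb _ _ _ hx _ (hgb _ _ _ hy _ hz)
  rw [← add_assoc] at h
  simpa using h

/-- If the weight `-c` of `h` is semisimple, then every element agrees with an element of `g (-i)`
of weight `-c` in its Killing pairing with the elements of `g i` of weight `c`. -/
lemma exists_killingForm_eq_of_graded [DecidableEq ι] (hg : DirectSum.IsInternal g)
    (hgb : ∀ i j : ι, ∀ x ∈ g i, ∀ y ∈ g j, ⁅x, y⁆ ∈ g (i + j)) {h : L} (hh : h ∈ g 0) (i : ι)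
    (c : K) (hc : ∀ x : L, ⁅h, ⁅h, x⁆ + c • x⁆ + c • (⁅h, x⁆ + c • x) = 0 → ⁅h, x⁆ + c • x = 0)
    (y : L) : ∃ y₀ ∈ g (-i), ⁅h, y₀⁆ = (-c) • y₀ ∧
      ∀ x ∈ g i, ⁅h, x⁆ = c • x → killingForm K L x y = killingForm K L x y₀ := by
  have hy : y ∈ ⨆ j, g j := by rw [hg.submodule_iSup_eq_top]; trivial
  induction hy using Submodule.iSup_induction' with
  | zero => exact ⟨0, zero_mem _, by simp, by simp⟩
  | add y z _ _ hy hz =>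
    obtain ⟨y₀, hy₀, hy₁, hy₂⟩ := hy
    obtain ⟨z₀, hz₀, hz₁, hz₂⟩ := hz
    refine ⟨y₀ + z₀, add_mem hy₀ hz₀, by rw [lie_add, hy₁, hz₁, smul_add], fun x hx hx' => ?_⟩
    rw [map_add, map_add, hy₂ x hx hx', hz₂ x hx hx']
  | mem j y hy =>
    by_cases hij : i + j = 0
    · obtain rfl : j = -i := (neg_eq_of_add_eq_zero_right hij).symm
      let G : Module.End K L := LieAlgebra.ad K L h + c • 1
      have hG (x : L) : G x = ⁅h, x⁆ + c • x := rfl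
      obtain ⟨a, ha, b, -, hGa, rfl⟩ := G.exists_add_apply_eq (p := g (-i))
        (fun x hx => add_mem (by simpa using hgb _ _ _ hh _ hx) (Submodule.smul_mem _ _ hx))
        (fun x _ hx => hc x hx) hy
      refine ⟨a, ha, ?_, fun x _ hx' => ?_⟩
      · rw [neg_smul]; exact eq_neg_of_add_eq_zero_left hGa
      · have h1 := LieModule.traceForm_apply_lie_apply' K L L h x b
        rw [hx', map_smul, LinearMap.smul_apply] at h1
        change c • killingForm K L x b = - killingForm K L x _ at h1
        rw [map_add, hG, map_add, map_smul, h1]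
        simp
    · exact ⟨0, zero_mem _, by simp, fun x hx _ => by
        rw [killingForm_eq_zero_of_graded hg hgb hij hx hy, map_zero]⟩

/-- A subspace contains every element which is Killing orthogonal to its orthogonal complement. -/
lemma mem_of_killingForm_eq_zero [LieAlgebra.IsKilling K L] {W : Submodule K L} {x : L}
    (hx : ∀ y, (∀ w ∈ W, killingForm K L w y = 0) → killingForm K L x y = 0) : x ∈ W := by
  have hs : (killingForm K L).IsRefl := (LieModule.traceForm_isSymm K L L).isRefl
  rw [← LinearMap.BilinForm.orthogonal_orthogonal (LieAlgebra.IsKilling.killingForm_nondegenerate K L)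
    hs W]
  intro y hy
  exact hs.eq_iff.mp (hx y hy)

end Graded

/-- Let `(h, e, f)` be an `sl₂`-triple with `h ∈ g₀`, `e ∈ g₁`, `f ∈ g₋₁`, and for `k ∈ ℤ`
let `g_k(h/2) = {x ∈ g_{k mod m} : ⁅h, x⁆ = 2k • x}`.  If `e' ∈ g₁(h/2)` is generic, i.e.
`⁅g₀(h/2), e'⁆ = g₁(h/2)`, then there is `f' ∈ g₋₁(h/2)` making `(h, e', f')` an
`sl₂`-triple. -/
theorem generic_element_mem_sl2_triple {m : ℕ} [NeZero m] {L : Type*} [LieRing L]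
    [LieAlgebra ℝ L] [Module.Finite ℝ L] [LieAlgebra.IsSemisimple ℝ L]
    (g : ZMod m → Submodule ℝ L) (hg : DirectSum.IsInternal g)
    (hgb : ∀ i j : ZMod m, ∀ x ∈ g i, ∀ y ∈ g j, ⁅x, y⁆ ∈ g (i + j))
    (h e f : L) (hh : h ∈ g 0) (he : e ∈ g 1) (hf : f ∈ g (-1 : ZMod m))
    (ht1 : ⁅h, e⁆ = (2 : ℝ) • e) (ht2 : ⁅h, f⁆ = (-2 : ℝ) • f) (ht3 : ⁅e, f⁆ = h)
    (e' : L) (he'1 : e' ∈ g 1) (he'2 : ⁅h, e'⁆ = (2 : ℝ) • e')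
    (hgen' : {w | ∃ y, (y ∈ g 0 ∧ ⁅h, y⁆ = 0) ∧ w = ⁅y, e'⁆} =
      {x | x ∈ g 1 ∧ ⁅h, x⁆ = (2 : ℝ) • x}) :
    ∃ f' : L, f' ∈ g (-1 : ZMod m) ∧ ⁅h, f'⁆ = (-2 : ℝ) • f' ∧
      ⁅h, e'⁆ = (2 : ℝ) • e' ∧ ⁅e', f'⁆ = h := by
  let ad := LieAlgebra.ad ℝ L
  have had (x y : L) : ad x y = ⁅x, y⁆ := rfl
  have hE (v : L) : ad h (ad e v) = ad e (ad h v) + (2 : ℝ) • ad e v := by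
    simp only [had]; rw [leibniz_lie, ht1, smul_lie, add_comm]
  have hF (v : L) : ad h (ad f v) = ad f (ad h v) - (2 : ℝ) • ad f v := by
    simp only [had]; rw [leibniz_lie, ht2, smul_lie]; module
  have hEF (v : L) : ad e (ad f v) = ad f (ad e v) + ad h v := by
    simp only [had]; rw [leibniz_lie, ht3, add_comm]
  obtain ⟨a, ha⟩ := Module.End.isNilpotent_of_shift (H := ad h) (E := ad e) two_ne_zero
    (LinearMap.ext hE)
  have hFn : IsNilpotent (ad f) := Module.End.isNilpotent_of_shift (H := ad h)
    (c := (-2 : ℝ)) (by norm_num) (LinearMap.ext fun v => by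
      rw [neg_smul, ← sub_eq_add_neg]; exact hF v)
  have hss (c : ℝ) (x : L) (hx : ⁅h, ⁅h, x⁆ + c • x⁆ + c • (⁅h, x⁆ + c • x) = 0) :
      ⁅h, x⁆ + c • x = 0 := by
    have := Module.End.sl2_semisimple hE hF hEF hFn a (v := x) (μ := -c) (by rw [ha]; rfl)
      (by simp only [had, neg_smul, sub_neg_eq_add]; exact eq_neg_of_add_eq_zero_left hx)
    rw [had] at this
    rw [this]; module
  have hinv (x y z : L) : killingForm ℝ L ⁅x, y⁆ z = killingForm ℝ L x ⁅y, z⁆ :=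
    LieModule.traceForm_apply_lie_apply ℝ L L x y z
  -- the Killing form pairs the weight spaces `S i c` and `S (-i) (-c)` perfectly
  let S (i : ZMod m) (c : ℝ) : Submodule ℝ L := g i ⊓ (ad h).eigenspace c
  have hS {i : ZMod m} {c : ℝ} {x : L} : x ∈ S i c ↔ x ∈ g i ∧ ⁅h, x⁆ = c • x := by
    rw [Submodule.mem_inf, Module.End.mem_eigenspace_iff, had]
  have hSlie {i j : ZMod m} {c d : ℝ} {x y : L} (hx : x ∈ S i c) (hy : y ∈ S j d) :
      ⁅x, y⁆ ∈ S (i + j) (c + d) := by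
    rw [hS] at hx hy ⊢
    refine ⟨hgb _ _ _ hx.1 _ hy.1, ?_⟩
    rw [leibniz_lie, hx.2, hy.2, smul_lie, lie_smul, add_smul]
  have hproj (i : ZMod m) (c : ℝ) (y : L) : ∃ y₀ ∈ S (-i) (-c), ∀ x ∈ S i c,
      killingForm ℝ L x y = killingForm ℝ L x y₀ := by
    obtain ⟨y₀, h1, h2, h3⟩ := exists_killingForm_eq_of_graded hg hgb hh i c (hss c) y
    exact ⟨y₀, hS.mpr ⟨h1, h2⟩, fun x hx => h3 x (hS.mp hx).1 (hS.mp hx).2⟩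
  have hnondeg {i : ZMod m} {c : ℝ} {x : L} (hx : x ∈ S i c)
      (hx0 : ∀ y ∈ S (-i) (-c), killingForm ℝ L x y = 0) : x = 0 := by
    have : x ∈ (⊥ : Submodule ℝ L) := mem_of_killingForm_eq_zero fun y _ => by
      obtain ⟨y₀, hy₀, hxy⟩ := hproj i c y
      rw [hxy x hx, hx0 y₀ hy₀]
    simpa using this
  have hh0 : h ∈ S 0 0 := hS.mpr ⟨hh, by simp⟩
  have heS : e ∈ S 1 2 := hS.mpr ⟨he, ht1⟩
  have heS' : e' ∈ S 1 2 := hS.mpr ⟨he'1, he'2⟩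
  have hadd0 {x y : L} (hx : x ∈ S 0 0) (hy : y ∈ S 1 2) : ⁅x, y⁆ ∈ S 1 2 := by
    simpa using hSlie hx hy
  -- `e` is generic
  have hgene (x : L) (hx : x ∈ S 1 2) : ∃ y ∈ S 0 0, ⁅y, e⁆ = x := by
    suffices x ∈ (S 0 0).map (ad e) by
      obtain ⟨y, hy, rfl⟩ := this
      exact ⟨-y, neg_mem hy, by rw [neg_lie, lie_skew]; rfl⟩
    refine mem_of_killingForm_eq_zero fun y hy => ?_
    obtain ⟨y₀, hy₀, hxy⟩ := hproj 1 2 y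
    suffices y₀ = 0 by rw [hxy x hx, this, map_zero]
    have h1 : ⁅e, y₀⁆ = 0 := by
      have h2 : ⁅e, y₀⁆ ∈ S 0 0 := by simpa using hSlie heS hy₀
      refine hnondeg h2 fun z hz => ?_
      rw [neg_zero, neg_zero] at hz
      have h3 := hy (ad e z) ⟨z, hz, rfl⟩
      have h4 : ad e z ∈ S 1 2 := by
        rw [had, ← lie_skew]; exact neg_mem (hadd0 hz heS)
      rw [hxy _ h4, had, ← lie_skew, map_neg, LinearMap.neg_apply, hinv, neg_eq_zero] at h3
      rw [LieModule.traceForm_comm]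
      exact h3
    by_contra hne
    obtain ⟨k, hk⟩ := hFn
    obtain ⟨i, -, hi⟩ := Module.End.sl2_primitive_weight hF hEF k h1 (hS.mp hy₀).2
      (by rw [hk]; rfl) hne
    have : (0 : ℝ) ≤ i := i.cast_nonneg
    linarith
  have hgene' (x : L) (hx : x ∈ S 1 2) : ∃ y ∈ S 0 0, ⁅y, e'⁆ = x := by
    obtain ⟨y, ⟨hy, hy'⟩, rfl⟩ := hgen'.ge (hS.mp hx)
    exact ⟨y, hS.mpr ⟨hy, by rw [hy', zero_smul]⟩, rfl⟩
  have hinj : Function.Injective ad := LieModule.IsFaithful.injective_toEnd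
  have hmul (x y : L) : ad x * ad y - ad y * ad x = ad ⁅x, y⁆ :=
    LinearMap.ext fun z => (lie_lie x y z).symm
  -- `h` is orthogonal to the centralizer of `e'` in `S 0 0`
  have hcent (y : L) (hy : y ∈ S 0 0) (hye : ⁅y, e'⁆ = 0) : killingForm ℝ L h y = 0 := by
    refine eq_zero_of_commute_of_generic ((S 0 0).map (ad : L →ₗ[ℝ] Module.End ℝ L))
      ((S 1 2).map (ad : L →ₗ[ℝ] Module.End ℝ L)) (ad e) (ad e') ?_
      (LinearMap.trace ℝ L ∘ₗ LinearMap.mulLeft ℝ (ad h)) ?_ ?_ ?_ ?_ ?_ ⟨e', heS', rfl⟩ ?_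
      (ad y) ⟨y, hy, rfl⟩ ?_
    · rintro _ ⟨x, hx, rfl⟩ _ ⟨z, hz, rfl⟩
      exact ⟨⁅x, z⁆, by simpa using hSlie hx hz, (hmul x z).symm⟩
    · rintro _ ⟨x, hx, rfl⟩ _ ⟨z, hz, rfl⟩
      have h1 : killingForm ℝ L h ⁅x, z⁆ = 0 := by
        rw [← hinv, (hS.mp hx).2]; simp
      exact (congrArg (fun t => LinearMap.trace ℝ L (ad h * t)) (hmul x z)).trans h1
    · rintro _ ⟨x, hx, rfl⟩
      exact ⟨⁅x, e⁆, hadd0 hx heS, (hmul x e).symm⟩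
    · rintro _ ⟨x, hx, rfl⟩
      obtain ⟨z, hz, rfl⟩ := hgene x hx
      exact ⟨_, ⟨z, hz, rfl⟩, hmul z e⟩
    · rintro _ ⟨x, hx, rfl⟩
      exact ⟨⁅x, e'⁆, hadd0 hx heS', (hmul x e').symm⟩
    · rintro _ ⟨x, hx, rfl⟩
      obtain ⟨z, hz, rfl⟩ := hgene' x hx
      exact ⟨_, ⟨z, hz, rfl⟩, hmul z e'⟩
    · rintro _ ⟨x, hx, rfl⟩ hxe
      have h1 : ⁅x, e⁆ = 0 := hinj (by rw [← hmul, map_zero]; exact sub_eq_zero.mpr hxe)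
      change killingForm ℝ L h x = 0
      rw [← ht3, ← lie_skew, map_neg, LinearMap.neg_apply, hinv, ← lie_skew, h1]
      simp
    · rw [← sub_eq_zero, hmul, hye, map_zero]
  obtain ⟨f', hf', hef⟩ : h ∈ (S (-1) (-2)).map (ad e') := by
    refine mem_of_killingForm_eq_zero fun y hy => ?_
    obtain ⟨y₀, hy₀, hxy⟩ := hproj 0 0 y
    rw [neg_zero, neg_zero] at hy₀
    rw [hxy h hh0]
    refine hcent y₀ hy₀ (hnondeg (hadd0 hy₀ heS') fun u hu => ?_)
    have h1 : ⁅e', u⁆ ∈ S 0 0 := by simpa using hSlie heS' hu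
    rw [hinv, LieModule.traceForm_comm]
    exact (hxy _ h1).symm.trans (hy _ ⟨u, hu, rfl⟩)
  exact ⟨f', (hS.mp hf').1, (hS.mp hf').2, he'2, hef⟩
end

section
/- Let g = ⊕_{i ∈ ℤ/mℤ} g_i be a finite-dimensional real ℤ_m-graded semisimple Lie algebra, let e ∈ g_1 be a nonzero nilpotent element, and let (h, e, f) be an sl₂-triple with h ∈ g_0 and f ∈ g_{−1}. Then u_{g_0}(e) := Z_{g_0}(e) ∩ ⁅g_{−1}, e⁆ is an ideal of the Lie algebra Z_{g_0}(e) which is invariant under ad h and which is nilpotent as a Lie algebra. -/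
/-- Left-nested Lie brackets: `nestedBracket f n = ⁅f n, ⁅f (n-1), … ⁅f 1, f 0⁆…⁆⁆`.
A Lie subalgebra is nilpotent as a Lie algebra precisely when, for some `n`, all such
nested brackets of `n + 1` of its elements vanish. -/
def nestedBracket {L : Type*} [LieRing L] (f : ℕ → L) : ℕ → L
  | 0 => f 0
  | (n + 1) => ⁅f (n + 1), nestedBracket f n⁆

section

attribute [local instance] LieRing.ofAssociativeRing

open LieAlgebra in
/-- **Jacobson's lemma**: if `e` is nilpotent and commutes with `⁅e, w⁆`, then `⁅e, w⁆` is
nilpotent. -/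
theorem isNilpotent_lie_of_lie_lie_eq_zero {A : Type*} [Ring A] [Algebra ℝ A] {e w : A}
    (he : IsNilpotent e) (hw : ⁅e, ⁅e, w⁆⁆ = 0) : IsNilpotent ⁅e, w⁆ := by
  set D := ad ℝ A e with hD
  have leibniz (x y : A) : D (x * y) = D x * y + x * D y := by
    simp only [hD, ad_apply, Ring.lie_def]
    noncomm_ring
  have leibniz_iterate (k : ℕ) (x : A) :
      (D ^ (k + 1)) (w * x) = w * (D ^ (k + 1)) x + (k + 1 : ℝ) • (D w * (D ^ k) x) := by
    induction k with
    | zero => simp [leibniz, add_comm]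
    | succ k ih =>
      have hDw : D (D w) = 0 := hw
      have hpow (j : ℕ) (y : A) : (D ^ (j + 1)) y = D ((D ^ j) y) := by
        rw [pow_succ', Module.End.mul_apply]
      rw [hpow (k + 1), ih, map_add, map_smul, leibniz, leibniz, hDw, zero_mul,
        zero_add, hpow (k + 1) x, hpow k x]
      push_cast
      module
  have iterate_pow (n : ℕ) : (D ^ (n + 1)) (w ^ n) = 0 ∧
      (D ^ n) (w ^ n) = (n.factorial : ℝ) • D w ^ n := by
    induction n with
    | zero => simp [hD, Ring.lie_def]
    | succ n ih =>
      obtain ⟨ih₁, ih₂⟩ := ih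
      have h₁ : (D ^ (n + 1 + 1)) (w ^ n) = 0 := by
        rw [pow_succ', Module.End.mul_apply, ih₁, map_zero]
      rw [pow_succ' w, leibniz_iterate, leibniz_iterate, h₁, ih₁, ih₂]
      refine ⟨by simp, ?_⟩
      rw [Nat.factorial_succ, pow_succ' (D w)]
      simp [smul_smul]
  obtain ⟨n, hn⟩ : IsNilpotent D := ad_nilpotent_of_nilpotent he
  refine ⟨n, ?_⟩
  have h := (iterate_pow n).2
  rw [hn, LinearMap.zero_apply, eq_comm, smul_eq_zero] at h
  exact h.resolve_left (by exact_mod_cast n.factorial_ne_zero)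

/-- Jacobson's lemma for ad-nilpotent elements of a Lie algebra. -/
theorem isNilpotent_ad_lie_of_lie_lie_eq_zero {L : Type*} [LieRing L] [LieAlgebra ℝ L] {e w : L}
    (he : IsNilpotent (LieAlgebra.ad ℝ L e)) (hw : ⁅e, ⁅e, w⁆⁆ = 0) :
    IsNilpotent (LieAlgebra.ad ℝ L ⁅e, w⁆) := by
  rw [LieHom.map_lie]
  exact isNilpotent_lie_of_lie_lie_eq_zero he
    (by rw [← LieHom.map_lie, ← LieHom.map_lie, hw, map_zero])

end

/-- Nested brackets of elements of a nilpotent Lie subalgebra eventually vanish. -/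
theorem exists_nestedBracket_eq_zero {L : Type*} [LieRing L] [LieAlgebra ℝ L]
    (U : LieSubalgebra ℝ L) [LieRing.IsNilpotent U] :
    ∃ n : ℕ, ∀ c : ℕ → L, (∀ i, c i ∈ U) → nestedBracket c n = 0 := by
  obtain ⟨n, hn⟩ := (LieModule.isNilpotent_iff ℝ U U).mp inferInstance
  refine ⟨n, fun c hc ↦ ?_⟩
  have mem_lcs (k : ℕ) :
      ∃ x ∈ LieModule.lowerCentralSeries ℝ U U k, (x : L) = nestedBracket c k := by
    induction k with
    | zero => exact ⟨⟨c 0, hc 0⟩, by simp, rfl⟩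
    | succ k ih =>
      obtain ⟨x, hx, hxc⟩ := ih
      refine ⟨⁅(⟨c (k + 1), hc _⟩ : U), x⁆, ?_, by simp [nestedBracket, hxc]⟩
      rw [LieModule.lowerCentralSeries_succ]
      exact LieSubmodule.lie_mem_lie (LieSubmodule.mem_top _) hx
  obtain ⟨x, hx, hxc⟩ := mem_lcs n
  rw [hn, LieSubmodule.mem_bot] at hx
  simp [← hxc, hx]

/-- For an `sl₂`-triple `(h, e, f)` attached to a nonzero nilpotent `e ∈ g₁`, the subspace
`u_{g₀}(e) = Z_{g₀}(e) ∩ ⁅g₋₁, e⁆` is an `ad h`-invariant ideal of the Lie algebra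
`Z_{g₀}(e)` which is nilpotent as a Lie algebra. -/
theorem centralizer_inter_bracket_nilpotent_ideal {m : ℕ} [NeZero m] {L : Type*} [LieRing L]
    [LieAlgebra ℝ L] [Module.Finite ℝ L] [LieAlgebra.IsSemisimple ℝ L]
    (g : ZMod m → Submodule ℝ L) (hg : DirectSum.IsInternal g)
    (hgb : ∀ i j : ZMod m, ∀ x ∈ g i, ∀ y ∈ g j, ⁅x, y⁆ ∈ g (i + j))
    (e h f : L) (he : e ∈ g 1) (hene : e ≠ 0)
    (henil : IsNilpotent (LieAlgebra.ad ℝ L e))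
    (hh : h ∈ g 0) (hf : f ∈ g (-1 : ZMod m))
    (ht1 : ⁅h, e⁆ = (2 : ℝ) • e) (ht2 : ⁅h, f⁆ = (-2 : ℝ) • f) (ht3 : ⁅e, f⁆ = h)
    (u : Set L)
    (hu : u = {z | (z ∈ g 0 ∧ ⁅z, e⁆ = 0) ∧
      z ∈ Submodule.span ℝ {w | ∃ y ∈ g (-1 : ZMod m), w = ⁅y, e⁆}}) :
    (∀ y, (y ∈ g 0 ∧ ⁅y, e⁆ = 0) → ∀ z ∈ u, ⁅y, z⁆ ∈ u) ∧
      (∀ z ∈ u, ⁅h, z⁆ ∈ u) ∧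
      (∃ n : ℕ, ∀ c : ℕ → L, (∀ i, c i ∈ u) → nestedBracket c n = 0) := by
  let ade : L →ₗ[ℝ] L := LieAlgebra.ad ℝ L e
  have mem_u (z : L) : z ∈ u ↔ (z ∈ g 0 ∧ ⁅z, e⁆ = 0) ∧ ∃ w ∈ g (-1), ⁅e, w⁆ = z := by
    have hspan : Submodule.span ℝ {w | ∃ y ∈ g (-1 : ZMod m), w = ⁅y, e⁆} =
        (g (-1)).map ade := by
      rw [← Submodule.span_eq (Submodule.map ade _)]
      congr 1
      ext w
      constructor
      · rintro ⟨y, hy, rfl⟩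
        exact ⟨-y, neg_mem hy, by simp [ade]⟩
      · rintro ⟨y, hy, rfl⟩
        exact ⟨-y, neg_mem hy, by simp [ade]⟩
    rw [hu, Set.mem_ofPred_eq, hspan]
    rfl
  have ideal (y : L) (hy : y ∈ g 0 ∧ ⁅y, e⁆ = 0) (z : L) (hz : z ∈ u) : ⁅y, z⁆ ∈ u := by
    obtain ⟨⟨hz₀, hze⟩, w, hw, rfl⟩ := (mem_u z).mp hz
    refine (mem_u _).mpr ⟨⟨by simpa using hgb 0 0 _ hy.1 _ hz₀, ?_⟩, ⁅y, w⁆,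
      by simpa using hgb 0 (-1) _ hy.1 _ hw, ?_⟩
    · rw [lie_lie, hze, hy.2, lie_zero, lie_zero, sub_zero]
    · rw [leibniz_lie y e w, hy.2, zero_lie, zero_add]
  refine ⟨ideal, fun z hz ↦ ?_, ?_⟩
  · obtain ⟨⟨hz₀, hze⟩, w, hw, rfl⟩ := (mem_u z).mp hz
    refine (mem_u _).mpr ⟨⟨by simpa using hgb 0 0 _ hh _ hz₀, ?_⟩, (2 : ℝ) • w + ⁅h, w⁆,
      add_mem (Submodule.smul_mem _ _ hw) (by simpa using hgb 0 (-1) _ hh _ hw), ?_⟩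
    · rw [lie_lie, hze, ht1, lie_smul, hze, lie_zero, smul_zero, sub_zero]
    · rw [leibniz_lie h e w, ht1, lie_add, lie_smul, smul_lie]
  · let U : LieSubalgebra ℝ L :=
      { carrier := u
        zero_mem' := (mem_u 0).mpr ⟨⟨zero_mem _, zero_lie _⟩, 0, zero_mem _, lie_zero _⟩
        add_mem' := by
          intro a b ha hb
          obtain ⟨⟨ha₀, hae⟩, v, hv, rfl⟩ := (mem_u a).mp ha
          obtain ⟨⟨hb₀, hbe⟩, w, hw, rfl⟩ := (mem_u b).mp hb
          exact (mem_u _).mpr ⟨⟨add_mem ha₀ hb₀, by rw [add_lie, hae, hbe, add_zero]⟩,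
            v + w, add_mem hv hw, lie_add _ _ _⟩
        smul_mem' := by
          intro c a ha
          obtain ⟨⟨ha₀, hae⟩, v, hv, rfl⟩ := (mem_u a).mp ha
          exact (mem_u _).mpr ⟨⟨Submodule.smul_mem _ _ ha₀, by rw [smul_lie, hae, smul_zero]⟩,
            c • v, Submodule.smul_mem _ _ hv, lie_smul _ _ _⟩
        lie_mem' := fun {a b} ha hb ↦ ideal a ((mem_u a).mp ha).1 b hb }
    have : LieRing.IsNilpotent U := by
      rw [LieAlgebra.isNilpotent_iff_forall (R := ℝ)]
      rintro ⟨z, hz⟩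
      refine LieSubalgebra.isNilpotent_ad_of_isNilpotent_ad U ?_
      obtain ⟨⟨-, hze⟩, w, -, rfl⟩ := (mem_u z).mp hz
      exact isNilpotent_ad_lie_of_lie_lie_eq_zero henil (by rw [← lie_skew, hze, neg_zero])
    exact exists_nestedBracket_eq_zero U
end

section
/- Let g^ℂ = ⊕_{k ∈ ℤ/mℤ} g_k^ℂ be a finite-dimensional complex ℤ_m-graded Lie algebra and let θ be the associated ℂ-linear automorphism acting on g_k^ℂ by multiplication by e^{2πik/m}. Let τ be a conjugate-linear involutive Lie ring automorphism of g^ℂ (a real structure) and let g = {x ∈ g^ℂ : τ(x) = x} be the corresponding real form. Then τ ∘ θ = θ^{−1} ∘ τ if and only if g decomposes as the direct sum of real subspaces g = ⊕_{k ∈ ℤ/mℤ} (g ∩ g_k^ℂ); moreover, when these hold, τ(g_k^ℂ) = g_k^ℂ for every k. -/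
theorem Module.End.eigenspace_eq_of_isInternal {K V ι : Type*} [Field K] [AddCommGroup V]
    [Module K V] [DecidableEq ι] (f : Module.End K V) {ζ : ι → K} (hζ : Function.Injective ζ)
    {g : ι → Submodule K V} (hg : DirectSum.IsInternal g)
    (hf : ∀ i, ∀ x ∈ g i, f x = ζ i • x) (i : ι) :
    f.eigenspace (ζ i) = g i := by
  have hle (j : ι) : g j ≤ f.eigenspace (ζ j) := fun x hx =>
    Module.End.mem_eigenspace_iff.mpr (hf j x hx)
  refine le_antisymm ?_ (hle i)
  have hdisj : f.eigenspace (ζ i) ⊓ ⨆ j ≠ i, g j = ⊥ :=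
    ((f.eigenspaces_iSupIndep.comp hζ i).mono_right
      (iSup₂_mono fun j _ => hle j)).eq_bot
  have htop : g i ⊔ ⨆ j ≠ i, g j = ⊤ := by
    refine top_le_iff.mp (hg.submodule_iSup_eq_top.ge.trans (iSup_le fun j => ?_))
    by_cases h : j = i
    · exact h ▸ le_sup_left
    · exact (le_iSup₂ (f := fun j (_ : j ≠ i) => g j) j h).trans le_sup_right
  calc f.eigenspace (ζ i) = (g i ⊔ ⨆ j ≠ i, g j) ⊓ f.eigenspace (ζ i) := by
        rw [htop, top_inf_eq]
    _ ≤ g i := by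
        rw [sup_inf_assoc_of_le _ (hle i), inf_comm, hdisj, sup_bot_eq]

theorem DirectSum.IsInternal.exists_eq_sum {K V ι : Type*} [Semiring K] [AddCommMonoid V]
    [Module K V] [DecidableEq ι] [Fintype ι] {g : ι → Submodule K V}
    (hg : DirectSum.IsInternal g) (x : V) :
    ∃ c : ι → V, (∀ i, c i ∈ g i) ∧ x = ∑ i, c i := by
  obtain ⟨c, hc, hx⟩ := (Submodule.mem_iSup_iff_exists_finsupp g x).mp
    (hg.submodule_iSup_eq_top ▸ Submodule.mem_top)
  exact ⟨c, hc, by rw [← hx, Finsupp.sum_fintype _ _ fun _ => rfl]⟩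

theorem Complex.exp_two_pi_mul_I_mul_val_div_eq_pow {m : ℕ} (k : ZMod m) :
    Complex.exp (2 * Real.pi * Complex.I * (k.val : ℂ) / (m : ℂ)) =
      Complex.exp (2 * Real.pi * Complex.I / (m : ℂ)) ^ k.val := by
  rw [← Complex.exp_nat_mul]
  congr 1
  ring

theorem Complex.injective_exp_two_pi_mul_I_mul_val_div (m : ℕ) [NeZero m] :
    Function.Injective fun k : ZMod m =>
      Complex.exp (2 * Real.pi * Complex.I * (k.val : ℂ) / (m : ℂ)) := by
  intro j k h
  simp only [Complex.exp_two_pi_mul_I_mul_val_div_eq_pow] at h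
  exact ZMod.val_injective m
    ((Complex.isPrimitiveRoot_exp m (NeZero.ne m)).pow_inj (ZMod.val_lt j) (ZMod.val_lt k) h)

theorem Complex.exp_two_pi_mul_I_mul_val_div_mul_conj {m : ℕ} (k : ZMod m) :
    Complex.exp (2 * Real.pi * Complex.I * (k.val : ℂ) / (m : ℂ)) *
      starRingEnd ℂ (Complex.exp (2 * Real.pi * Complex.I * (k.val : ℂ) / (m : ℂ))) = 1 := by
  rw [← Complex.exp_conj, ← Complex.exp_add]
  simp [neg_div, map_ofNat]

/-- Every vector is a complex combination of fixed points of a conjugate-linear involution. -/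
theorem exists_fixed_add_I_smul_fixed {V : Type*} [AddCommGroup V] [Module ℂ V]
    (T : V →ₛₗ[starRingEnd ℂ] V) (hT : ∀ x, T (T x) = x) (x : V) :
    ∃ a b : V, T a = a ∧ T b = b ∧ x = a + Complex.I • b := by
  refine ⟨(1 / 2 : ℂ) • (x + T x), (-Complex.I / 2) • (x - T x), ?_, ?_, ?_⟩
  · simp [map_smulₛₗ, map_ofNat, hT, add_comm]
  · simp only [map_smulₛₗ, map_sub, hT, map_div₀, map_neg, Complex.conj_I, map_ofNat]
    module
  · rw [smul_smul, show Complex.I * (-Complex.I / 2) = 1 / 2 by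
      linear_combination (-1 / 2 : ℂ) * Complex.I_mul_I]
    module

/-- Let `g^ℂ` be a finite-dimensional complex `ℤ/m`-graded Lie algebra with associated
automorphism `θ` (acting on `g_k^ℂ` by `e^{2πik/m}`), and let `τ` be a real structure
(conjugate-linear involutive Lie ring automorphism) with real form `g = Fix τ`.  Then
`τ ∘ θ = θ⁻¹ ∘ τ` if and only if `g` decomposes as `g = ⊕_k (g ∩ g_k^ℂ)`; moreover, when
these hold, `τ(g_k^ℂ) = g_k^ℂ` for every `k`. -/
theorem real_form_compatible_iff_graded {m : ℕ} [NeZero m] {L : Type*} [LieRing L]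
    [LieAlgebra ℂ L] [Module.Finite ℂ L]
    (g : ZMod m → Submodule ℂ L) (hg : DirectSum.IsInternal g)
    (hgb : ∀ i j : ZMod m, ∀ x ∈ g i, ∀ y ∈ g j, ⁅x, y⁆ ∈ g (i + j))
    (θ : L ≃ₗ[ℂ] L)
    (hθ : ∀ k : ZMod m, ∀ x ∈ g k,
      θ x = Complex.exp (2 * Real.pi * Complex.I * (k.val : ℂ) / (m : ℂ)) • x)
    (τ : L → L)
    (hadd : ∀ x y : L, τ (x + y) = τ x + τ y)
    (hsmul : ∀ (c : ℂ) (x : L), τ (c • x) = (starRingEnd ℂ c) • τ x)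
    (hbr : ∀ x y : L, τ ⁅x, y⁆ = ⁅τ x, τ y⁆)
    (hinv : ∀ x : L, τ (τ x) = x) :
    ((∀ x : L, τ (θ x) = θ.symm (τ x)) ↔
      ∀ x : L, τ x = x → ∃ c : ZMod m → L,
        (∀ k, c k ∈ g k ∧ τ (c k) = c k) ∧ x = ∑ k : ZMod m, c k) ∧
    ((∀ x : L, τ (θ x) = θ.symm (τ x)) →
      ∀ k : ZMod m, τ '' (g k : Set L) = (g k : Set L)) := by
  set ζ : ZMod m → ℂ := fun k =>
    Complex.exp (2 * Real.pi * Complex.I * (k.val : ℂ) / (m : ℂ))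
  have hζ_inj : Function.Injective ζ := Complex.injective_exp_two_pi_mul_I_mul_val_div m
  have hζ_conj (k : ZMod m) : ζ k * starRingEnd ℂ (ζ k) = 1 :=
    Complex.exp_two_pi_mul_I_mul_val_div_mul_conj k
  have hmem {k : ZMod m} {x : L} : θ x = ζ k • x → x ∈ g k := fun hx => by
    rw [← Module.End.eigenspace_eq_of_isInternal (θ : L →ₗ[ℂ] L) hζ_inj hg hθ k]
    exact Module.End.mem_eigenspace_iff.mpr hx
  let T : L →ₛₗ[starRingEnd ℂ] L := { toFun := τ, map_add' := hadd, map_smul' := hsmul }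
  have hT (x : L) : T x = τ x := rfl
  have hmaps (h : ∀ x : L, τ (θ x) = θ.symm (τ x)) (k : ZMod m) {x : L} (hx : x ∈ g k) :
      τ x ∈ g k := by
    apply hmem
    have hconj : θ.symm (τ x) = starRingEnd ℂ (ζ k) • τ x := by
      rw [← h, hθ k x hx, hsmul]
    rw [LinearEquiv.symm_apply_eq, map_smul] at hconj
    rw [hconj, smul_smul, hζ_conj, one_smul, ← hconj]
  refine ⟨⟨fun h x hx => ?_, fun h => ?_⟩, fun h k => ?_⟩
  · obtain ⟨c, hc, hxc⟩ := hg.exists_eq_sum x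
    refine ⟨fun k => (1 / 2 : ℂ) • (c k + τ (c k)), fun k =>
      ⟨(g k).smul_mem _ ((g k).add_mem (hc k) (hmaps h k (hc k))), ?_⟩, ?_⟩
    · rw [hsmul, hadd, hinv, add_comm]
      simp [map_ofNat]
    · have hsum : ∑ k, τ (c k) = x := by
        simp only [← hT]
        rw [← map_sum, ← hxc, hT, hx]
      rw [← Finset.smul_sum, Finset.sum_add_distrib, hsum, ← hxc]
      module
  · have hfix (x : L) (hx : τ x = x) : τ (θ x) = θ.symm (τ x) := by
      obtain ⟨c, hc, rfl⟩ := h x hx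
      rw [hx, map_sum, map_sum, ← hT, map_sum]
      refine Finset.sum_congr rfl fun k _ => ?_
      rw [hT, hθ k _ (hc k).1, hsmul, (hc k).2, eq_comm, LinearEquiv.symm_apply_eq, map_smul,
        hθ k _ (hc k).1, smul_smul, mul_comm]
      exact (by rw [hζ_conj, one_smul] : c k = (ζ k * starRingEnd ℂ (ζ k)) • c k)
    intro x
    obtain ⟨a, b, ha, hb, rfl⟩ := exists_fixed_add_I_smul_fixed T hinv x
    simp only [map_add, map_smul, hadd, hsmul, hfix a ha, hfix b hb]
  · refine Set.Subset.antisymm ?_ fun x hx => ⟨τ x, hmaps h k hx, hinv x⟩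
    rintro _ ⟨x, hx, rfl⟩
    exact hmaps h k hx
end
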